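/- arXiv:1407.2977 — 4 statements merged into one kernel-verified Lean document; each statement's English description precedes it below -/
import Mathlib

section
/- Let X be a real Banach space admitting a C¹ Lipschitz bump function, let Ω ⊆ X be a nonempty bounded open set with ∂Ω ≠ ∅, and let h : X → ℝ satisfy |h(y) − h(z)| ≤ ‖y − z‖ for all y, z ∈ ∂Ω. Then the eikonal equation with boundary data h has a unique viscosity solution: if v : cl(Ω) → ℝ is continuous, v(x) = h(x) for all x ∈ ∂Ω, ‖Δ‖ ≥ 1 for every x ∈ Ω and Δ ∈ D⁻v(x), and ‖Λ‖ ≤ 1 for every x ∈ Ω and Λ ∈ D⁺v(x), then v(x) = inf{h(y) + ‖y − x‖ : y ∈ ∂Ω} for every x ∈ cl(Ω). -/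
open Filter Topology

variable {X : Type*} [NormedAddCommGroup X] [NormedSpace ℝ X]

/-- `X` admits a `C¹` Lipschitz bump function. -/
def HasC1LipBump (X : Type*) [NormedAddCommGroup X] [NormedSpace ℝ X] : Prop :=
  ∃ b : X → ℝ, ContDiff ℝ 1 b ∧ (∃ K : NNReal, LipschitzWith K b) ∧
    Bornology.IsBounded (Function.support b) ∧ (Function.support b).Nonempty

/-- The Fréchet subdifferential at `x` of a real-valued function `f` regarded as a
function defined on the set `Ω`. -/
def subdiffOn (Ω : Set X) (f : X → ℝ) (x : X) : Set (X →L[ℝ] ℝ) :=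
  {Δ | ∀ ε > (0:ℝ), ∃ δ > (0:ℝ), ∀ h : X, ‖h‖ < δ → x + h ∈ Ω →
    f x + Δ h - ε * ‖h‖ ≤ f (x + h)}

/-- The Fréchet superdifferential at `x` of a real-valued function `f` regarded as a
function defined on the set `Ω`. -/
def superdiffOn (Ω : Set X) (f : X → ℝ) (x : X) : Set (X →L[ℝ] ℝ) :=
  {Δ | ∀ ε > (0:ℝ), ∃ δ > (0:ℝ), ∀ h : X, ‖h‖ < δ → x + h ∈ Ω →
    f (x + h) ≤ f x + Δ h + ε * ‖h‖}

/-- A differentiable function with bounded derivative which equals `1` at the origin, takes values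
in `[0, 1]` and vanishes outside the open unit ball. -/
structure IsUnitBump {E : Type*} [NormedAddCommGroup E] [NormedSpace ℝ E] (b : E → ℝ) (K : ℝ) :
    Prop where
  differentiable : Differentiable ℝ b
  map_zero : b 0 = 1
  nonneg : ∀ x, 0 ≤ b x
  le_one : ∀ x, b x ≤ 1
  eq_zero : ∀ x, 1 ≤ ‖x‖ → b x = 0
  norm_fderiv_le : ∀ x, ‖fderiv ℝ b x‖ ≤ K

theorem HasC1LipBump.exists_isUnitBump (hX : HasC1LipBump X) :
    ∃ (b : X → ℝ) (K : ℝ), IsUnitBump b K := by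
  obtain ⟨b, hb, ⟨K, hK⟩, hbdd, x₀, hx₀⟩ := hX
  have hx₀' : b x₀ ≠ 0 := hx₀
  obtain ⟨R, hRpos, hR⟩ := hbdd.exists_pos_norm_lt
  set c : ℝ := Real.pi / 2 / b x₀ with hc
  set i : X → ℝ := fun x => c * b (x₀ + (2 * R) • x) with hi
  have hder : ∀ x, HasFDerivAt (fun x => Real.sin (i x) ^ 2)
      ((2 * Real.sin (i x)) • (Real.cos (i x) • (c • ((2 * R) •
        fderiv ℝ b (x₀ + (2 * R) • x))))) x := by
    intro x
    have h1 : HasFDerivAt (fun x : X => x₀ + (2 * R) • x)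
        ((2 * R) • ContinuousLinearMap.id ℝ X) x :=
      ((hasFDerivAt_id x).const_smul (2 * R)).const_add x₀
    have h2 := (hb.differentiable one_ne_zero (x₀ + (2 * R) • x)).hasFDerivAt.comp x h1
    have h3 := ((h2.const_mul c).sin).pow 2
    refine HasFDerivAt.congr_fderiv h3 ?_
    ext w
    simp [hi]
  refine ⟨fun x => Real.sin (i x) ^ 2, 2 * (|c| * (2 * R * K)),
    fun x => (hder x).differentiableAt, ?_, fun x => by positivity, fun x => Real.sin_sq_le_one _,
    ?_, ?_⟩
  · have : i 0 = Real.pi / 2 := by simp [hi, hc, hx₀']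
    simp [this]
  · intro x hx
    have : b (x₀ + (2 * R) • x) = 0 := by
      by_contra hne
      have h1 := hR _ (show x₀ + (2 * R) • x ∈ Function.support b from hne)
      have h2 := hR _ hx₀
      have h3 : ‖(2 * R) • x‖ ≤ ‖x₀ + (2 * R) • x‖ + ‖x₀‖ := by
        simpa using norm_sub_le (x₀ + (2 * R) • x) x₀
      rw [norm_smul, Real.norm_of_nonneg (by positivity)] at h3
      nlinarith
    simp [hi, this]
  · intro x
    rw [(hder x).fderiv]
    have h1 : ‖fderiv ℝ b (x₀ + (2 * R) • x)‖ ≤ K := norm_fderiv_le_of_lipschitz ℝ hK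
    simp only [norm_smul, Real.norm_eq_abs, abs_mul, abs_two, abs_of_pos hRpos]
    have h2 := Real.abs_sin_le_one (i x)
    have h3 := Real.abs_cos_le_one (i x)
    calc 2 * |Real.sin (i x)| * (|Real.cos (i x)| * (|c| * (2 * R * _)))
        ≤ 2 * 1 * (1 * (|c| * (2 * R * K))) := by gcongr
      _ = _ := by ring

theorem IsUnitBump.prod {E : Type*} [NormedAddCommGroup E] [NormedSpace ℝ E] {b : E → ℝ} {K : ℝ}
    (hb : IsUnitBump b K) : IsUnitBump (fun z : E × E => b z.1 * b z.2) (2 * K) := by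
  have hder : ∀ z : E × E, HasFDerivAt (fun z : E × E => b z.1 * b z.2)
      (b z.1 • (fderiv ℝ b z.2).comp (ContinuousLinearMap.snd ℝ E E) +
        b z.2 • (fderiv ℝ b z.1).comp (ContinuousLinearMap.fst ℝ E E)) z := fun z =>
    ((hb.differentiable z.1).hasFDerivAt.comp z hasFDerivAt_fst).mul
      ((hb.differentiable z.2).hasFDerivAt.comp z hasFDerivAt_snd)
  refine ⟨fun z => (hder z).differentiableAt, by simp [hb.map_zero],
    fun z => mul_nonneg (hb.nonneg _) (hb.nonneg _),
    fun z => mul_le_one₀ (hb.le_one _) (hb.nonneg _) (hb.le_one _), fun z hz => ?_, fun z => ?_⟩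
  · rw [Prod.norm_def, le_max_iff] at hz
    rcases hz with h | h <;> simp [hb.eq_zero _ h]
  · rw [(hder z).fderiv]
    have hK : 0 ≤ K := (norm_nonneg _).trans (hb.norm_fderiv_le 0)
    have key : ∀ (x y : E) (L : E × E →L[ℝ] E), ‖L‖ ≤ 1 →
        ‖b x • (fderiv ℝ b y).comp L‖ ≤ K := by
      intro x y L hL
      rw [norm_smul, Real.norm_of_nonneg (hb.nonneg _)]
      calc b x * ‖(fderiv ℝ b y).comp L‖ ≤ 1 * (K * 1) := by
            gcongr
            · exact hb.le_one _
            · exact (ContinuousLinearMap.opNorm_comp_le _ _).trans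
                (by gcongr; exact hb.norm_fderiv_le _)
        _ = K := by ring
    calc _ ≤ K + K := (norm_add_le _ _).trans (add_le_add
            (key _ _ _ (ContinuousLinearMap.norm_snd_le ..))
            (key _ _ _ (ContinuousLinearMap.norm_fst_le ..)))
      _ = 2 * K := by ring

/-- A bump rescaled to have support in the ball of radius `1 / lam` around `a`. -/
theorem IsUnitBump.hasFDerivAt_rescale {E : Type*} [NormedAddCommGroup E] [NormedSpace ℝ E]
    {b : E → ℝ} {K : ℝ} (hb : IsUnitBump b K) (lam : ℝ) (a w : E) :
    HasFDerivAt (fun w => b (lam • (w - a))) (lam • fderiv ℝ b (lam • (w - a))) w := by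
  have h1 : HasFDerivAt (fun w : E => lam • (w - a)) (lam • ContinuousLinearMap.id ℝ E) w :=
    ((hasFDerivAt_id w).sub_const a).const_smul lam
  refine HasFDerivAt.congr_fderiv
    ((hb.differentiable (lam • (w - a))).hasFDerivAt.comp w h1) ?_
  ext; simp

/-- The smooth variational principle: a continuous function bounded below on a closed set attains
its minimum there after adding a small perturbation that is differentiable with small derivative. -/
theorem IsUnitBump.exists_perturbation_min {E : Type*} [NormedAddCommGroup E] [NormedSpace ℝ E]
    [CompleteSpace E] {b : E → ℝ} {K : ℝ} (hb : IsUnitBump b K) {S : Set E} (hS : IsClosed S)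
    (hne : S.Nonempty) {F : E → ℝ} (hF : ContinuousOn F S) (hbdd : BddBelow (F '' S))
    {η : ℝ} (hη : 0 < η) :
    ∃ z ∈ S, ∃ (P : E → ℝ) (P' : E →L[ℝ] ℝ), HasFDerivAt P P' z ∧ ‖P'‖ ≤ 2 * K * η ∧
      (∀ w, |P w| ≤ 2 * η) ∧ ∀ w ∈ S, F z + P z ≤ F w + P w := by
  obtain ⟨m, hm⟩ := hbdd
  have hK : 0 ≤ K := (norm_nonneg _).trans (hb.norm_fderiv_le 0)
  set e : ℕ → ℝ := fun n => η * (1 / 8) ^ n with he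
  have epos : ∀ n, 0 < e n := fun n => by positivity
  have esucc : ∀ n, e (n + 1) = e n / 8 := fun n => by simp only [he, pow_succ]; ring
  have hsum_e : Summable e :=
    (summable_geometric_of_lt_one (by norm_num) (by norm_num : (1 / 8 : ℝ) < 1)).mul_left η
  have elim0 : Tendsto e atTop (𝓝 0) := hsum_e.tendsto_atTop_zero
  have hsel : ∀ (n : ℕ) (G : E → ℝ), ∃ z ∈ S, BddBelow ((fun w => F w + G w) '' S) →
      ∀ w ∈ S, F z + G z ≤ F w + G w + e n / 4 := by
    intro n G
    by_cases hG : BddBelow ((fun w => F w + G w) '' S)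
    · obtain ⟨_, ⟨z, hz, rfl⟩, hlt⟩ := exists_lt_of_csInf_lt (hne.image fun w => F w + G w)
        (lt_add_of_pos_right (sInf ((fun w => F w + G w) '' S))
          (show 0 < e n / 4 by linarith [epos n]))
      refine ⟨z, hz, fun _ w hw => ?_⟩
      have := csInf_le hG ⟨w, hw, rfl⟩
      simp only at this hlt
      linarith
    · exact ⟨hne.some, hne.some_mem, fun h => absurd h hG⟩
  choose sel selS selmin using hsel
  let G : ℕ → E → ℝ := fun n => Nat.rec (motive := fun _ => E → ℝ) (fun _ => 0)
    (fun n G w => G w + -(e n * b ((2 : ℝ) ^ n • (w - sel n G)))) n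
  set z : ℕ → E := fun n => sel n (G n) with hz
  set p : ℕ → E → ℝ := fun n w => -(e n * b ((2 : ℝ) ^ n • (w - z n))) with hp
  have hG0 : ∀ w, G 0 w = 0 := fun w => rfl
  have hGs : ∀ n w, G (n + 1) w = G n w + p n w := fun n w => rfl
  have hpabs : ∀ n w, |p n w| ≤ e n := by
    intro n w
    simp only [hp, abs_neg, abs_mul, abs_of_pos (epos n), abs_of_nonneg (hb.nonneg _)]
    exact mul_le_of_le_one_right (epos n).le (hb.le_one _)
  have hGdiff : ∀ n k w, |G (n + k) w - G n w| ≤ 2 * e n - 2 * e (n + k) := by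
    intro n k w
    induction k with
    | zero => simp
    | succ k ih =>
      rw [← add_assoc, hGs, esucc]
      have h1 := hpabs (n + k) w
      have h2 := epos (n + k)
      rw [abs_le] at *
      constructor <;> linarith
  have hGdiff' : ∀ n k, n ≤ k → ∀ w, |G k w - G n w| ≤ 2 * e n := by
    intro n k hnk w
    obtain ⟨j, rfl⟩ := Nat.exists_eq_add_of_le hnk
    linarith [hGdiff n j w, epos (n + j)]
  have hzS : ∀ n, z n ∈ S := fun n => selS n (G n)
  have hzmin : ∀ n, ∀ w ∈ S, F (z n) + G n (z n) ≤ F w + G n w + e n / 4 := by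
    intro n
    refine selmin n (G n) ⟨m - 2 * e 0, ?_⟩
    rintro _ ⟨w, hw, rfl⟩
    have h1 := hm ⟨w, hw, rfl⟩
    have h2 := abs_le.1 (hGdiff' 0 n (Nat.zero_le _) w)
    rw [hG0] at h2
    simp only
    linarith
  have hclose : ∀ n, dist (z n) (z (n + 1)) ≤ 1 * (1 / 2) ^ n := by
    intro n
    by_contra! hfar
    have hzero : p n (z (n + 1)) = 0 := by
      simp only [hp]
      rw [hb.eq_zero, mul_zero, neg_zero]
      rw [norm_smul, norm_pow, Real.norm_two, ← dist_eq_norm, dist_comm]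
      rw [one_mul, one_div, inv_pow] at hfar
      calc (1 : ℝ) = 2 ^ n * (2 ^ n)⁻¹ := by field_simp
        _ ≤ _ := by gcongr
    have hone : p n (z n) = -e n := by simp [hp, hb.map_zero]
    have h1 := hzmin (n + 1) (z n) (hzS n)
    have h2 := hzmin n (z (n + 1)) (hzS (n + 1))
    rw [hGs, hGs, hzero, hone, esucc] at h1
    linarith [epos n]
  have hcauchy := cauchySeq_of_le_geometric (1 / 2 : ℝ) 1 (by norm_num) hclose
  obtain ⟨a, ha⟩ := cauchySeq_tendsto_of_complete hcauchy
  have haS : a ∈ S := hS.mem_of_tendsto ha (Eventually.of_forall hzS)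
  have hsum_p : ∀ w, Summable fun n => p n w := fun w =>
    Summable.of_norm_bounded hsum_e (hpabs · w)
  have hGP : ∀ w, Tendsto (fun n => G n w) atTop (𝓝 (∑' n, p n w)) := by
    intro w
    have : ∀ n, G n w = ∑ k ∈ Finset.range n, p k w := by
      intro n
      induction n with
      | zero => simp [hG0]
      | succ n ih => rw [hGs, ih, Finset.sum_range_succ]
    simp only [this]
    exact (hsum_p w).hasSum.tendsto_sum_nat
  have hPG : ∀ n w, |∑' k, p k w - G n w| ≤ 2 * e n := fun n w =>
    le_of_tendsto ((hGP w).sub_const _).abs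
      ((eventually_ge_atTop n).mono fun k hk => hGdiff' n k hk w)
  have hu : HasSum (fun n : ℕ => K * η * (1 / 2) ^ n) (2 * K * η) := by
    rw [show 2 * K * η = K * η * 2 by ring]
    exact hasSum_geometric_two.mul_left (K * η)
  have hp' : ∀ n w, HasFDerivAt (p n)
      (-(e n • ((2 : ℝ) ^ n • fderiv ℝ b ((2 : ℝ) ^ n • (w - z n))))) w := fun n w =>
    ((hb.hasFDerivAt_rescale _ _ w).const_mul (e n)).neg
  have hpb : ∀ n w, ‖-(e n • ((2 : ℝ) ^ n • fderiv ℝ b ((2 : ℝ) ^ n • (w - z n))))‖ ≤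
      K * η * (1 / 2) ^ n := by
    intro n w
    rw [norm_neg, norm_smul, norm_smul, Real.norm_of_nonneg (epos n).le, norm_pow, Real.norm_two]
    calc e n * (2 ^ n * _) ≤ e n * (2 ^ n * K) := by
          have := epos n
          gcongr
          exact hb.norm_fderiv_le _
      _ = K * η * ((1 / 8) ^ n * 2 ^ n) := by simp only [he]; ring
      _ = K * η * (1 / 4) ^ n := by rw [← mul_pow]; norm_num
      _ ≤ K * η * (1 / 2) ^ n := by gcongr; norm_num
  have hP := hasFDerivAt_tsum hu.summable hp' hpb (hsum_p a)
  refine ⟨a, haS, fun w => ∑' n, p n w, _, hP a,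
    tsum_of_norm_bounded hu (hpb · a), fun w => ?_, fun w hw => ?_⟩
  · simpa [hG0, he] using hPG 0 w
  · have hlim : Tendsto (fun n => F (z n) + ∑' k, p k (z n)) atTop
        (𝓝 (F a + ∑' k, p k a)) :=
      ((hF a haS).tendsto.comp (tendsto_nhdsWithin_iff.2 ⟨ha, Eventually.of_forall hzS⟩)).add
        ((hP a).continuousAt.tendsto.comp ha)
    have hlim' : Tendsto (fun n => F w + ∑' k, p k w + 5 * e n) atTop
        (𝓝 (F w + ∑' k, p k w)) := by
      simpa using (elim0.const_mul 5).const_add (F w + ∑' k, p k w)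
    refine le_of_tendsto_of_tendsto' hlim hlim' fun n => ?_
    have h1 := abs_le.1 (hPG n (z n))
    have h2 := abs_le.1 (hPG n w)
    linarith [hzmin n w hw, epos n]

theorem neg_fderiv_mem_subdiffOn {S : Set X} {F Q : X → ℝ} {L : X →L[ℝ] ℝ} {x : X}
    (hQ : HasFDerivAt Q L x) (hmin : ∀ w ∈ S, F x + Q x ≤ F w + Q w) : -L ∈ subdiffOn S F x := by
  intro ε hε
  rw [hasFDerivAt_iff_isLittleO_nhds_zero] at hQ
  obtain ⟨δ, hδ, hball⟩ := Metric.eventually_nhds_iff.1 (hQ.def hε)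
  refine ⟨δ, hδ, fun h hh hS => ?_⟩
  have h1 := hball (show dist h 0 < δ by simpa using hh)
  rw [Real.norm_eq_abs, abs_le] at h1
  have h2 := hmin _ hS
  simp only [neg_apply]
  linarith

/-- The fuzzy sum rule, with approximate minimality: near any approximate minimizer of `f + g` there
are almost opposite subgradients of `f` and `g`. -/
theorem HasC1LipBump.exists_almost_opposite_subgradients [CompleteSpace X] (hX : HasC1LipBump X)
    {C : Set X} (hC : IsClosed C) {f g : X → ℝ} (hf : ContinuousOn f C) (hfb : BddBelow (f '' C))
    (hg : Continuous g) (hg0 : ∀ y, 0 ≤ g y) {x₀ : X} (hx₀ : x₀ ∈ C)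
    {δ η ε : ℝ} (hδ : 0 < δ) (hη : 0 < η) (hε : 0 < ε) :
    ∃ x ∈ C, ∃ y, ‖x - y‖ < δ ∧ f x + g y ≤ f x₀ + g x₀ + η ∧
      ∃ p ∈ subdiffOn Set.univ g y, ∃ q ∈ subdiffOn C f x, ‖p + q‖ ≤ ε := by
  obtain ⟨b, K, hb⟩ := hX.exists_isUnitBump
  have hK : 0 ≤ K := (norm_nonneg _).trans (hb.norm_fderiv_le 0)
  obtain ⟨m, hm⟩ := hfb
  set M : ℝ := f x₀ + g x₀ + η - m + 1 with hM
  set φ : X → ℝ := fun w => M * (1 - b (δ⁻¹ • (w - 0))) with hφ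
  have hφd : ∀ w, HasFDerivAt φ (M • -(δ⁻¹ • fderiv ℝ b (δ⁻¹ • (w - 0)))) w := fun w =>
    ((hb.hasFDerivAt_rescale δ⁻¹ 0 w).const_sub 1).const_mul M
  have hmx₀ : m ≤ f x₀ := hm ⟨x₀, hx₀, rfl⟩
  have hMpos : 0 < M := by linarith [hg0 x₀]
  have hφ0 : φ 0 = 0 := by simp [hφ, hb.map_zero]
  have hφnonneg : ∀ w, 0 ≤ φ w := fun w =>
    mul_nonneg hMpos.le (by linarith [hb.le_one (δ⁻¹ • (w - 0))])
  have hφcont : Continuous φ := continuous_iff_continuousAt.2 fun w => (hφd w).continuousAt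
  set F : X × X → ℝ := fun z => f z.1 + g z.2 + φ (z.1 - z.2) with hFdef
  have hF : ContinuousOn F (C ×ˢ Set.univ) := by
    refine ((hf.comp continuousOn_fst fun z hz => hz.1).add ?_).add ?_
    · exact (hg.comp continuous_snd).continuousOn
    · exact (hφcont.comp (continuous_fst.sub continuous_snd)).continuousOn
  have hFb : BddBelow (F '' (C ×ˢ Set.univ)) := by
    refine ⟨m, ?_⟩
    rintro _ ⟨z, hz, rfl⟩
    have : m ≤ f z.1 := hm ⟨z.1, hz.1, rfl⟩
    simp only [hFdef]
    linarith [hg0 z.2, hφnonneg (z.1 - z.2)]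
  obtain ⟨κ, hκ, hκη, hκε⟩ : ∃ κ : ℝ, 0 < κ ∧ 4 * κ ≤ η ∧ 2 * (2 * (2 * K) * κ) ≤ ε := by
    refine ⟨min (η / 4) (ε / (8 * (K + 1))), by positivity, ?_, ?_⟩
    · linarith [min_le_left (η / 4) (ε / (8 * (K + 1)))]
    · calc 2 * (2 * (2 * K) * min (η / 4) (ε / (8 * (K + 1))))
          ≤ 2 * (2 * (2 * (K + 1)) * (ε / (8 * (K + 1)))) := by
            gcongr
            · linarith
            · exact min_le_right _ _
        _ = ε := by field_simp; norm_num
  obtain ⟨⟨x, y⟩, hz, P, P', hP, hP', hPb, hmin⟩ :=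
    hb.prod.exists_perturbation_min (hC.prod isClosed_univ) ⟨(x₀, x₀), hx₀, trivial⟩ hF hFb hκ
  have hxC : x ∈ C := hz.1
  have hmx : m ≤ f x := hm ⟨x, hxC, rfl⟩
  have hval : f x + g y + φ (x - y) ≤ f x₀ + g x₀ + η := by
    have h1 := hmin (x₀, x₀) ⟨hx₀, trivial⟩
    have h2 := abs_le.1 (hPb (x, y))
    have h3 := abs_le.1 (hPb (x₀, x₀))
    simp only [hFdef, sub_self, hφ0] at h1
    linarith
  set D : X →L[ℝ] ℝ := M • -(δ⁻¹ • fderiv ℝ b (δ⁻¹ • (x - y - 0))) with hD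
  have hPx : HasFDerivAt (fun w => φ (w - y) + P (w, y))
      (D + P'.comp (ContinuousLinearMap.inl ℝ X X)) x := by
    refine HasFDerivAt.add ?_ (hP.comp x (hasFDerivAt_prodMk_left x y))
    exact ((hφd (x - y)).comp x ((hasFDerivAt_id x).sub_const y)).congr_fderiv
      (ContinuousLinearMap.comp_id D)
  have hPy : HasFDerivAt (fun w => φ (x - w) + P (x, w))
      (-D + P'.comp (ContinuousLinearMap.inr ℝ X X)) y := by
    refine HasFDerivAt.add ?_ (hP.comp y (hasFDerivAt_prodMk_right x y))
    exact ((hφd (x - y)).comp y ((hasFDerivAt_id y).const_sub x)).congr_fderiv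
      (by ext; simp [hD])
  refine ⟨x, hxC, y, ?_, by linarith [hφnonneg (x - y)], _,
    neg_fderiv_mem_subdiffOn hPy fun w _ => ?_, _, neg_fderiv_mem_subdiffOn hPx fun w hw => ?_, ?_⟩
  · by_contra! hfar
    have : b (δ⁻¹ • (x - y - 0)) = 0 := by
      refine hb.eq_zero _ ?_
      rw [sub_zero, norm_smul, norm_inv, Real.norm_of_nonneg hδ.le]
      calc 1 = δ⁻¹ * δ := by field_simp
        _ ≤ _ := by gcongr
    have h1 : φ (x - y) = M := by simp only [hφ, this]; ring
    linarith [hg0 y]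
  · have := hmin (x, w) ⟨hxC, trivial⟩
    simp only [hFdef] at this
    linarith
  · have := hmin (w, y) ⟨hw, trivial⟩
    simp only [hFdef] at this
    linarith
  · have hsum : -(-D + P'.comp (ContinuousLinearMap.inr ℝ X X)) +
        -(D + P'.comp (ContinuousLinearMap.inl ℝ X X)) =
        -(P'.comp (ContinuousLinearMap.inr ℝ X X) + P'.comp (ContinuousLinearMap.inl ℝ X X)) := by
      abel
    rw [hsum, norm_neg]
    have key : ∀ L : X →L[ℝ] X × X, ‖L‖ ≤ 1 → ‖P'.comp L‖ ≤ 2 * (2 * K) * κ := fun L hL =>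
      (ContinuousLinearMap.opNorm_comp_le _ _).trans
        ((mul_le_of_le_one_right (norm_nonneg _) hL).trans hP')
    calc _ ≤ 2 * (2 * K) * κ + 2 * (2 * K) * κ := (norm_add_le _ _).trans (add_le_add
            (key _ (ContinuousLinearMap.norm_inr_le_one ..))
            (key _ (ContinuousLinearMap.norm_inl_le_one ..)))
      _ ≤ ε := by linarith

theorem apply_le_of_mem_subdiffOn {g : X → ℝ} {y : X} {p : X →L[ℝ] ℝ}
    (hp : p ∈ subdiffOn Set.univ g y) {h : X} {a : ℝ}
    (ha : ∀ t : ℝ, 0 < t → t ≤ 1 → g (y + t • h) ≤ g y + t * a) : p h ≤ a := by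
  refine le_of_forall_pos_le_add fun ε hε => ?_
  have hpos : 0 < ‖h‖ + 1 := by positivity
  obtain ⟨δ, hδ, hsub⟩ := hp (ε / (‖h‖ + 1)) (by positivity)
  set t : ℝ := min 1 (δ / (2 * (‖h‖ + 1))) with ht
  have htpos : 0 < t := by positivity
  have htδ : t * (2 * (‖h‖ + 1)) ≤ δ := by
    rw [← le_div_iff₀ (by positivity)]; exact min_le_right _ _
  have hnorm : ‖t • h‖ = t * ‖h‖ := by rw [norm_smul, Real.norm_of_nonneg htpos.le]
  have h1 := hsub (t • h) (by rw [hnorm]; nlinarith) trivial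
  have h2 := ha t htpos (min_le_left _ _)
  rw [hnorm, map_smul, smul_eq_mul] at h1
  have h3 : ε / (‖h‖ + 1) * ‖h‖ ≤ ε := by
    rw [div_mul_eq_mul_div, div_le_iff₀ hpos]; nlinarith
  have h4 : t * (p h) ≤ t * (a + ε / (‖h‖ + 1) * ‖h‖) := by linarith
  linarith [le_of_mul_le_mul_left h4 htpos]

theorem norm_le_of_mem_subdiffOn {g : X → ℝ} {y : X} {p : X →L[ℝ] ℝ}
    (hp : p ∈ subdiffOn Set.univ g y) {θ : ℝ} (hθ : 0 ≤ θ)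
    (hg : ∀ w, g w ≤ g y + θ * ‖w - y‖) : ‖p‖ ≤ θ := by
  have key : ∀ h, p h ≤ θ * ‖h‖ := fun h =>
    apply_le_of_mem_subdiffOn hp fun t ht _ => by
      have := hg (y + t • h)
      rw [add_sub_cancel_left, norm_smul, Real.norm_of_nonneg ht.le] at this
      linarith
  refine p.opNorm_le_bound hθ fun h => abs_le.2 ⟨?_, key h⟩
  have := key (-h)
  rw [map_neg, norm_neg] at this
  linarith

theorem le_norm_of_mem_subdiffOn {g : X → ℝ} {y y₀ : X} {p : X →L[ℝ] ℝ}
    (hp : p ∈ subdiffOn Set.univ g y) {c : ℝ} (hy : y ≠ y₀)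
    (hg : ∀ t : ℝ, 0 < t → t ≤ 1 → g (y + t • (y₀ - y)) ≤ g y - t * (c * ‖y - y₀‖)) :
    c ≤ ‖p‖ := by
  have h1 : p (y₀ - y) ≤ -(c * ‖y - y₀‖) := apply_le_of_mem_subdiffOn hp fun t ht ht1 => by
    linarith [hg t ht ht1]
  have h2 := neg_le_of_abs_le (p.le_opNorm (y₀ - y))
  rw [norm_sub_rev] at h2
  exact le_of_mul_le_mul_right (by linarith) (norm_pos_iff.2 (sub_ne_zero.2 hy))

/-- Local upper estimate for functions whose superdifferentials lie in the unit ball. -/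
theorem exists_local_upper_bound [CompleteSpace X] (hX : HasC1LipBump X) {Ω : Set X}
    (hΩ : IsOpen Ω) {v : X → ℝ} (hv : ContinuousOn v Ω)
    (hsub : ∀ x ∈ Ω, ∀ Λ ∈ superdiffOn (closure Ω) v x, ‖Λ‖ ≤ 1) {y₀ : X} (hy₀ : y₀ ∈ Ω)
    {c : ℝ} (hc : 1 < c) :
    ∃ M ≥ 0, ∃ r > 0, ∀ z, ‖z - y₀‖ < r → v z ≤ v y₀ + (c * ‖z - y₀‖ + M * ‖z - y₀‖ ^ 2) := by
  have hvat : ∀ x ∈ Ω, ContinuousAt v x := fun x hx => hv.continuousAt (hΩ.mem_nhds hx)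
  obtain ⟨r, hr, hball⟩ : ∃ r > 0, ∀ z ∈ Metric.closedBall y₀ r, z ∈ Ω ∧ |v z - v y₀| < 1 := by
    have hev : ∀ᶠ z in 𝓝 y₀, z ∈ Ω ∧ |v z - v y₀| < 1 :=
      (hΩ.eventually_mem hy₀).and
        ((hvat y₀ hy₀).eventually (Metric.ball_mem_nhds (v y₀) one_pos))
    exact (Metric.nhds_basis_closedBall.mem_iff).1 hev
  set M : ℝ := 1 / r ^ 2 with hM
  have hMpos : 0 < M := by positivity
  have hMr : M * r ^ 2 = 1 := by simp only [hM]; field_simp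
  refine ⟨M, hMpos.le, r, hr, fun z₀ hz₀ => ?_⟩
  by_contra! hbad
  set g : X → ℝ := fun z => c * ‖z - y₀‖ + M * ‖z - y₀‖ ^ 2 with hg
  obtain ⟨η, hη, hη4⟩ : ∃ η > 0, 4 * η = v z₀ - (v y₀ + g z₀) :=
    ⟨(v z₀ - (v y₀ + g z₀)) / 4, by linarith, by ring⟩
  have hgcont : Continuous g := by fun_prop
  have hg0 : ∀ z, 0 ≤ g z := fun z => by positivity
  obtain ⟨δ₁, hδ₁, hδ₁v⟩ := Metric.continuousAt_iff.1 (hvat y₀ hy₀) η hη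
  set A : ℝ := c + M * (2 * r + 1) with hA
  have hApos : 0 < A := by positivity
  have hδ : 0 < min (min 1 δ₁) (η / A) := by positivity
  have hfcont : ContinuousOn (fun z => -v z) (Metric.closedBall y₀ r) :=
    (hv.mono fun z hz => (hball z hz).1).neg
  have hfb : BddBelow ((fun z => -v z) '' Metric.closedBall y₀ r) := by
    refine ⟨-v y₀ - 1, ?_⟩
    rintro _ ⟨z, hz, rfl⟩
    have := abs_lt.1 (hball z hz).2
    simp only
    linarith
  obtain ⟨x, hxC, y, hxy, hval, p, hp, q, hq, hpq⟩ := hX.exists_almost_opposite_subgradients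
    Metric.isClosed_closedBall hfcont hfb hgcont hg0
    (show z₀ ∈ Metric.closedBall y₀ r by rw [mem_closedBall_iff_norm]; exact hz₀.le)
    hδ hη (show 0 < (c - 1) / 2 by linarith)
  have hxyδ : ‖x - y‖ < δ₁ := hxy.trans_le ((min_le_left _ _).trans (min_le_right _ _))
  have hxyA : ‖x - y‖ * A ≤ η := by
    rw [← le_div_iff₀ hApos]; exact (hxy.trans_le (min_le_right _ _)).le
  have hxy1 : ‖x - y‖ < 1 := hxy.trans_le ((min_le_left _ _).trans (min_le_left _ _))
  have hxΩ := (hball x hxC).1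
  have hxr : ‖x - y₀‖ ≤ r := by rwa [← mem_closedBall_iff_norm]
  have hxball : x ∈ Metric.ball y₀ r := by
    rw [mem_ball_iff_norm]
    by_contra! hge
    have h1 := abs_lt.1 (hball x hxC).2
    have h2 : ‖x - y₀‖ = r := le_antisymm hxr hge
    have h3 : ‖x - y₀‖ ≤ ‖x - y‖ + ‖y - y₀‖ := norm_sub_le_norm_sub_add_norm_sub x y y₀
    have h4 : g x ≤ g y + η := by
      set a := ‖x - y₀‖
      set b := ‖y - y₀‖
      set d := ‖x - y‖
      have hb : 0 ≤ b := norm_nonneg _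
      have hd : 0 ≤ d := norm_nonneg _
      have hba : b ≤ a + d := by
        have := norm_sub_le_norm_sub_add_norm_sub y x y₀
        rw [norm_sub_rev y x] at this
        linarith
      have h5 : (a - b) * (a + b) ≤ d * (2 * r + 1) := by
        have h51 : (a - b) * (a + b) ≤ d * (a + b) :=
          mul_le_mul_of_nonneg_right (by linarith) (by linarith)
        have h52 : d * (a + b) ≤ d * (2 * r + 1) :=
          mul_le_mul_of_nonneg_left (by linarith) hd
        linarith
      have h6 : M * ((a - b) * (a + b)) ≤ M * (d * (2 * r + 1)) :=
        mul_le_mul_of_nonneg_left h5 hMpos.le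
      have h7 : c * a ≤ c * (d + b) := mul_le_mul_of_nonneg_left h3 (by linarith)
      show c * a + M * a ^ 2 ≤ c * b + M * b ^ 2 + η
      have : d * A = c * d + M * (d * (2 * r + 1)) := by rw [hA]; ring
      nlinarith
    have h5 : 1 ≤ g x := by
      simp only [hg, h2, hMr]
      have : 0 ≤ c * r := by positivity
      linarith
    linarith
  have hyne : y ≠ y₀ := by
    rintro rfl
    have h1 := abs_lt.1 (hδ₁v (show dist x y < δ₁ by rwa [dist_eq_norm]))
    linarith [hg0 y]
  have hpc : c ≤ ‖p‖ := by
    refine le_norm_of_mem_subdiffOn hp hyne fun t ht ht1 => ?_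
    have h1 : ‖y + t • (y₀ - y) - y₀‖ = (1 - t) * ‖y - y₀‖ := by
      rw [show y + t • (y₀ - y) - y₀ = (1 - t) • (y - y₀) by module, norm_smul,
        Real.norm_of_nonneg (by linarith)]
    simp only [hg, h1]
    have h2 : ((1 - t) * ‖y - y₀‖) ^ 2 ≤ ‖y - y₀‖ ^ 2 := by
      have := norm_nonneg (y - y₀)
      gcongr
      exact mul_le_of_le_one_left this (by linarith)
    nlinarith [mul_le_mul_of_nonneg_left h2 hMpos.le]
  have hq1 : ‖q‖ ≤ 1 := by
    rw [← norm_neg]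
    refine hsub x hxΩ _ fun ε hε => ?_
    obtain ⟨δ, hδ', hqδ⟩ := hq ε hε
    obtain ⟨ρ, hρ, hρball⟩ := Metric.isOpen_iff.1 Metric.isOpen_ball x hxball
    refine ⟨min δ ρ, by positivity, fun h hh _ => ?_⟩
    have hmem : x + h ∈ Metric.ball y₀ r := hρball (by
      rw [mem_ball_iff_norm, add_sub_cancel_left]; exact hh.trans_le (min_le_right _ _))
    have := hqδ h (hh.trans_le (min_le_left _ _)) (Metric.ball_subset_closedBall hmem)
    simp only [neg_apply]
    linarith
  have : ‖p‖ ≤ ‖p + q‖ + ‖q‖ := by simpa using norm_sub_le (p + q) q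
  linarith

theorem le_add_norm_sub_of_segment_subset [CompleteSpace X] (hX : HasC1LipBump X) {Ω : Set X}
    (hΩ : IsOpen Ω) {v : X → ℝ} (hv : ContinuousOn v Ω)
    (hsub : ∀ x ∈ Ω, ∀ Λ ∈ superdiffOn (closure Ω) v x, ‖Λ‖ ≤ 1) {x y : X}
    (hxy : segment ℝ x y ⊆ Ω) : v y ≤ v x + ‖y - x‖ := by
  have key : ∀ c : ℝ, 1 < c → v y ≤ v x + c * ‖y - x‖ := by
    intro c hc
    set γ : ℝ → X := fun t => x + t • (y - x) with hγ
    have hγcont : Continuous γ := by fun_prop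
    have hγΩ : ∀ t ∈ Set.Icc (0 : ℝ) 1, γ t ∈ Ω := fun t ht => hxy <| by
      rw [segment_eq_image']; exact ⟨t, ht, rfl⟩
    have hγsub : ∀ s t, γ s - γ t = (s - t) • (y - x) := fun s t => by simp only [hγ]; module
    have := image_le_of_liminf_slope_right_le_deriv_boundary (f := fun t => v (γ t)) (a := 0)
      (b := 1) (hv.comp hγcont.continuousOn hγΩ) (B := fun t => v x + t * (c * ‖y - x‖))
      (B' := fun _ => c * ‖y - x‖) (by simp [hγ]) (by fun_prop)
      (fun t _ => by
        simpa using (((hasDerivAt_id t).mul_const (c * ‖y - x‖)).const_add (v x)).hasDerivWithinAt)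
      (fun t ht ρ hρ => ?_) (Set.right_mem_Icc.2 zero_le_one)
    · simpa [hγ] using this
    · obtain ⟨M, hM, r, hr, hbound⟩ := exists_local_upper_bound hX hΩ hv hsub
        (hγΩ t ⟨ht.1, ht.2.le⟩) hc
      have h1 : ∀ᶠ s in 𝓝[>] t, ‖γ s - γ t‖ < r := by
        refine nhdsWithin_le_nhds ?_
        have : Tendsto (fun s => ‖γ s - γ t‖) (𝓝 t) (𝓝 0) := by
          have hcont : Continuous fun s => ‖γ s - γ t‖ := by fun_prop
          simpa using hcont.tendsto t
        exact this.eventually (gt_mem_nhds hr)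
      have h2 : ∀ᶠ s in 𝓝[>] t, c * ‖y - x‖ + M * ‖y - x‖ ^ 2 * (s - t) < ρ := by
        refine nhdsWithin_le_nhds ?_
        have : Tendsto (fun s => c * ‖y - x‖ + M * ‖y - x‖ ^ 2 * (s - t)) (𝓝 t)
            (𝓝 (c * ‖y - x‖)) := by
          have hcont : Continuous fun s => c * ‖y - x‖ + M * ‖y - x‖ ^ 2 * (s - t) := by fun_prop
          simpa using hcont.tendsto t
        exact this.eventually (gt_mem_nhds hρ)
      refine Eventually.frequently ?_
      filter_upwards [h1, h2, self_mem_nhdsWithin] with s hs1 hs2 hs3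
      have hst : 0 < s - t := sub_pos.2 hs3
      have h3 := hbound (γ s) hs1
      rw [hγsub, norm_smul, Real.norm_of_nonneg hst.le] at h3
      rw [slope_def_field, div_lt_iff₀ hst]
      nlinarith [mul_lt_mul_of_pos_right hs2 hst]
  have hlim : Tendsto (fun c : ℝ => v x + c * ‖y - x‖) (𝓝[>] 1) (𝓝 (v x + ‖y - x‖)) := by
    have hcont : Continuous fun c : ℝ => v x + c * ‖y - x‖ := by fun_prop
    have := hcont.tendsto 1
    rw [one_mul] at this
    exact this.mono_left nhdsWithin_le_nhds
  exact ge_of_tendsto hlim (eventually_mem_nhdsWithin.mono key)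

/-- Along the segment from a point of `Ω` to a point outside `Ω`, the first exit point lies on the
boundary and `v` varies at most by the distance to it. -/
theorem exists_exit_point [CompleteSpace X] (hX : HasC1LipBump X) {Ω : Set X}
    (hΩ : IsOpen Ω) {v : X → ℝ} (hv : ContinuousOn v (closure Ω))
    (hsub : ∀ x ∈ Ω, ∀ Λ ∈ superdiffOn (closure Ω) v x, ‖Λ‖ ≤ 1) {x y : X}
    (hx : x ∈ Ω) (hy : y ∉ Ω) :
    ∃ z ∈ frontier Ω, ‖x - z‖ + ‖z - y‖ = ‖x - y‖ ∧ |v x - v z| ≤ ‖x - z‖ := by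
  set γ : ℝ → X := fun t => x + t • (y - x) with hγ
  have hγcont : Continuous γ := by fun_prop
  have hcomp : IsCompact (Set.Icc (0 : ℝ) 1 ∩ γ ⁻¹' Ωᶜ) :=
    isCompact_Icc.inter_right (hΩ.isClosed_compl.preimage hγcont)
  obtain ⟨T, ⟨⟨hT0, hT1⟩, hTΩ⟩, hTmin⟩ :=
    hcomp.exists_isLeast ⟨1, Set.right_mem_Icc.2 zero_le_one, by simpa [hγ] using hy⟩
  have hTpos : 0 < T := by
    refine hT0.lt_of_ne ?_
    rintro rfl
    exact hTΩ (by simpa [hγ] using hx)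
  have hin : ∀ s ∈ Set.Ico 0 T, γ s ∈ Ω := fun s hs => by
    by_contra hout
    exact hs.2.not_ge (hTmin ⟨⟨hs.1, hs.2.le.trans hT1⟩, hout⟩)
  have hseg : ∀ s ∈ Set.Ico 0 T, segment ℝ x (γ s) ⊆ Ω := by
    rintro s ⟨hs0, hsT⟩ _ hw
    rw [segment_eq_image'] at hw
    obtain ⟨t, ⟨ht0, ht1⟩, rfl⟩ := hw
    have : x + t • (γ s - x) = γ (t * s) := by simp only [hγ]; module
    simp only [this]
    exact hin _ ⟨by positivity, (mul_le_of_le_one_left hs0 ht1).trans_lt hsT⟩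
  have hlip : ∀ s ∈ Set.Ico 0 T, |v x - v (γ s)| ≤ ‖x - γ s‖ := by
    intro s hs
    have h1 := le_add_norm_sub_of_segment_subset hX hΩ (hv.mono subset_closure) hsub (hseg s hs)
    have h2 := le_add_norm_sub_of_segment_subset hX hΩ (hv.mono subset_closure) hsub
      (segment_symm ℝ x (γ s) ▸ hseg s hs)
    rw [norm_sub_rev] at h1
    exact abs_le.2 ⟨by linarith, by linarith⟩
  have hIco : ∀ᶠ s in 𝓝[<] T, s ∈ Set.Ico 0 T := Ico_mem_nhdsLT hTpos
  have hlimγ : Tendsto γ (𝓝[<] T) (𝓝 (γ T)) := (hγcont.tendsto T).mono_left nhdsWithin_le_nhds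
  have hcl : γ T ∈ closure Ω := mem_closure_of_tendsto hlimγ (hIco.mono hin)
  refine ⟨γ T, by rw [hΩ.frontier_eq]; exact ⟨hcl, hTΩ⟩, ?_, ?_⟩
  · have h1 : x - γ T = -(T • (y - x)) := by simp only [hγ]; module
    have h2 : γ T - y = -((1 - T) • (y - x)) := by simp only [hγ]; module
    rw [h1, h2, norm_neg, norm_neg, norm_smul, norm_smul, Real.norm_of_nonneg hT0,
      Real.norm_of_nonneg (by linarith), norm_sub_rev x y]
    ring
  · have hlimv : Tendsto (fun s => v (γ s)) (𝓝[<] T) (𝓝 (v (γ T))) :=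
      (hv _ hcl).tendsto.comp
        (tendsto_nhdsWithin_iff.2 ⟨hlimγ, hIco.mono fun s hs => subset_closure (hin s hs)⟩)
    exact le_of_tendsto_of_tendsto (hlimv.const_sub (v x)).abs (hlimγ.const_sub x).norm
      (hIco.mono hlip)

theorem stmt11 [CompleteSpace X] (hbump : HasC1LipBump X)
    (Ω : Set X) (hΩopen : IsOpen Ω) (hΩne : Ω.Nonempty)
    (hΩbdd : Bornology.IsBounded Ω) (hbd : (frontier Ω).Nonempty)
    (h : X → ℝ) (hLip : ∀ y ∈ frontier Ω, ∀ z ∈ frontier Ω, |h y - h z| ≤ ‖y - z‖)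
    (v : X → ℝ) (hvcont : ContinuousOn v (closure Ω))
    (hvbd : ∀ x ∈ frontier Ω, v x = h x)
    (hvsuper : ∀ x ∈ Ω, ∀ Δ ∈ subdiffOn (closure Ω) v x, 1 ≤ ‖Δ‖)
    (hvsub : ∀ x ∈ Ω, ∀ Λ ∈ superdiffOn (closure Ω) v x, ‖Λ‖ ≤ 1) :
    ∀ x ∈ closure Ω, v x = sInf ((fun y => h y + ‖y - x‖) '' frontier Ω) := by
  have hcases : ∀ x ∈ closure Ω, x ∈ Ω ∨ x ∈ frontier Ω := fun x hx => by
    rw [hΩopen.frontier_eq]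
    exact (em (x ∈ Ω)).imp_right fun hxΩ => ⟨hx, hxΩ⟩
  have hlip : ∀ x ∈ closure Ω, ∀ y ∈ frontier Ω, |v x - h y| ≤ ‖x - y‖ := by
    intro x hx y hy
    rcases hcases x hx with hxΩ | hxf
    · have hyΩ : y ∉ Ω := by rw [hΩopen.frontier_eq] at hy; exact hy.2
      obtain ⟨z, hz, hxzy, hvz⟩ := exists_exit_point hbump hΩopen hvcont hvsub hxΩ hyΩ
      rw [hvbd z hz] at hvz
      linarith [abs_sub_le (v x) (h z) (h y), hLip z hz y hy]
    · rw [hvbd x hxf]; exact hLip x hxf y hy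
  intro x hx
  have hupper : ∀ y ∈ frontier Ω, v x ≤ h y + ‖y - x‖ := fun y hy => by
    have := (abs_le.1 (hlip x hx y hy)).2
    rw [norm_sub_rev] at this
    linarith
  have hbelow : BddBelow ((fun y => h y + ‖y - x‖) '' frontier Ω) :=
    ⟨v x, by rintro _ ⟨y, hy, rfl⟩; exact hupper y hy⟩
  refine le_antisymm (le_csInf (hbd.image _) (by rintro _ ⟨y, hy, rfl⟩; exact hupper y hy)) ?_
  rcases hcases x hx with hxΩ | hxf
  swap
  · exact (csInf_le hbelow ⟨x, hxf, rfl⟩).trans (by simp [hvbd x hxf])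
  by_contra! hlt
  set W := sInf ((fun y => h y + ‖y - x‖) '' frontier Ω)
  have hW : ∀ y ∈ frontier Ω, W ≤ h y + ‖y - x‖ := fun y hy => csInf_le hbelow ⟨y, hy, rfl⟩
  obtain ⟨η, hη, hη4⟩ : ∃ η > 0, 4 * η = W - v x := ⟨(W - v x) / 4, by linarith, by ring⟩
  obtain ⟨R, hR⟩ : ∃ R, ∀ a ∈ closure Ω, ‖a‖ ≤ R := hΩbdd.closure.exists_norm_le
  have hRdist : ∀ a ∈ closure Ω, ∀ b ∈ closure Ω, ‖a - b‖ ≤ 2 * R := fun a ha b hb => by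
    linarith [norm_sub_le a b, hR a ha, hR b hb]
  have hRpos : 0 ≤ R := (norm_nonneg _).trans (hR x hx)
  obtain ⟨θ, hθ0, hθ1, hθη⟩ : ∃ θ : ℝ, 0 ≤ θ ∧ θ < 1 ∧ (1 - θ) * (2 * R) ≤ η := by
    have hpos : 0 < min 1 (η / (2 * R + 1)) := by positivity
    refine ⟨1 - min 1 (η / (2 * R + 1)), by linarith [min_le_left 1 (η / (2 * R + 1))],
      by linarith, ?_⟩
    rw [sub_sub_cancel]
    calc min 1 (η / (2 * R + 1)) * (2 * R) ≤ η / (2 * R + 1) * (2 * R + 1) := by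
          gcongr
          · exact min_le_right _ _
          · linarith
      _ = η := by field_simp
  obtain ⟨y₁, hy₁⟩ := hbd
  have hvb : BddBelow (v '' closure Ω) := by
    refine ⟨h y₁ - 2 * R, ?_⟩
    rintro _ ⟨a, ha, rfl⟩
    linarith [(abs_le.1 (hlip a ha y₁ hy₁)).1, hRdist a ha y₁ (frontier_subset_closure hy₁)]
  obtain ⟨a, ha, b, hab, hval, p, hp, q, hq, hpq⟩ := hbump.exists_almost_opposite_subgradients
    isClosed_closure hvcont hvb (g := fun y => θ * ‖y - x‖) (by fun_prop)
    (fun y => by positivity) hx hη hη (show 0 < (1 - θ) / 2 by linarith)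
  simp only [sub_self, norm_zero, mul_zero, add_zero] at hval
  have haΩ : a ∈ Ω := (hcases a ha).resolve_right fun haf => by
    have h1 := hW a haf
    have h2 := norm_sub_le_norm_sub_add_norm_sub a b x
    have h3 : (1 - θ) * ‖a - x‖ ≤ (1 - θ) * (2 * R) :=
      mul_le_mul_of_nonneg_left (hRdist a ha x hx) (by linarith)
    have h4 : θ * ‖a - x‖ ≤ θ * (‖a - b‖ + ‖b - x‖) := mul_le_mul_of_nonneg_left h2 hθ0
    have h5 : θ * ‖a - b‖ ≤ ‖a - b‖ := mul_le_of_le_one_left (norm_nonneg _) hθ1.le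
    rw [hvbd a haf] at hval
    linarith
  have hpθ : ‖p‖ ≤ θ := norm_le_of_mem_subdiffOn hp hθ0 fun w => by
    have := mul_le_mul_of_nonneg_left (norm_sub_le_norm_sub_add_norm_sub w b x) hθ0
    linarith
  have hq1 := hvsuper a haΩ q hq
  have : ‖q‖ ≤ ‖p + q‖ + ‖p‖ := by simpa using norm_sub_le (p + q) p
  linarith
end

section
/- Let X be a real Banach space admitting a C¹ Lipschitz bump function and let H : X × ℝ → ℝ be a continuous Hamiltonian satisfying condition (A). Suppose u : X → ℝ is a bounded viscosity subsolution of u(x) + H(x, ‖du(x)‖) = 0, v : X → ℝ is a bounded viscosity supersolution of the same equation, and for every x ∈ X at least one of u, v is Lipschitz on some neighborhood of x. Then inf_X (v − u) ≥ 0, i.e. u ≤ v on X. -/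
open Filter Topology

variable {X : Type*} [NormedAddCommGroup X] [NormedSpace ℝ X]

/-- The Fréchet subdifferential of a real-valued function `f` at `x`. -/
def subdiff (f : X → ℝ) (x : X) : Set (X →L[ℝ] ℝ) :=
  {Δ | ∀ ε > (0:ℝ), ∃ δ > (0:ℝ), ∀ h : X, ‖h‖ < δ →
    f x + Δ h - ε * ‖h‖ ≤ f (x + h)}

/-- The Fréchet superdifferential of a real-valued function `f` at `x`. -/
def superdiff (f : X → ℝ) (x : X) : Set (X →L[ℝ] ℝ) :=
  {Δ | ∀ ε > (0:ℝ), ∃ δ > (0:ℝ), ∀ h : X, ‖h‖ < δ →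
    f (x + h) ≤ f x + Δ h + ε * ‖h‖}

/-- Condition (A) for a Hamiltonian `H : X × ℝ → ℝ`. -/
def CondA (H : X → ℝ → ℝ) : Prop :=
  ∃ (C : ℝ) (ω : ℝ → ℝ → ℝ), 0 ≤ C ∧
    Continuous (fun p : ℝ × ℝ => ω p.1 p.2) ∧ ω 0 0 = 0 ∧
    ∀ (x₁ x₂ : X) (t₁ t₂ : ℝ),
      |H x₁ t₁ - H x₂ t₂| ≤ ω ‖x₁ - x₂‖ (t₁ - t₂) + C * max |t₁| |t₂| * ‖x₁ - x₂‖

/-- A normalized differentiable bump function: it takes values in `[0, 1]`, equals `1` at the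
origin, vanishes outside the ball of radius `R`, and its derivative is bounded by `L`. -/
structure IsNormalizedBump {E : Type*} [NormedAddCommGroup E] [NormedSpace ℝ E]
    (b : E → ℝ) (L R : ℝ) : Prop where
  differentiable : Differentiable ℝ b
  norm_fderiv_le : ∀ x, ‖fderiv ℝ b x‖ ≤ L
  nonneg : ∀ x, 0 ≤ b x
  le_one : ∀ x, b x ≤ 1
  map_zero : b 0 = 1
  radius_pos : 0 < R
  eq_zero : ∀ x, R ≤ ‖x‖ → b x = 0

theorem HasC1LipBump.exists_isNormalizedBump {E : Type*} [NormedAddCommGroup E]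
    [NormedSpace ℝ E] (h : HasC1LipBump E) :
    ∃ (b : E → ℝ) (L R : ℝ), IsNormalizedBump b L R := by
  obtain ⟨b, hb, ⟨K, hK⟩, hbd, ⟨a, ha⟩⟩ := h
  obtain ⟨r, hr0, hr⟩ := hbd.subset_ball_lt 0 a
  have ha0 : b a ≠ 0 := ha
  have hbound : ∀ x, |b x| ≤ |b a| + K * r := by
    intro x
    by_cases hx : b x = 0
    · rw [hx, abs_zero]; positivity
    · have h1 : dist x a < r := hr hx
      have h2 := hK.dist_le_mul x a
      rw [Real.dist_eq] at h2
      have h3 := abs_sub_abs_le_abs_sub (b x) (b a)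
      have h4 : (K : ℝ) * dist x a ≤ K * r := by gcongr
      linarith
  set M := (|b a| + K * r) / |b a| with hM
  have hc : Continuous (deriv Real.smoothTransition) :=
    (Real.smoothTransition.contDiff (n := 1)).continuous_deriv le_rfl
  obtain ⟨D, hD⟩ := (isCompact_Icc (a := -M) (b := M)).exists_bound_of_continuousOn hc.continuousOn
  have hdS : Differentiable ℝ Real.smoothTransition :=
    (Real.smoothTransition.contDiff (n := 1)).differentiable (by norm_num)
  have hdb : Differentiable ℝ b := hb.differentiable (by norm_num)
  have hd : ∀ x, HasFDerivAt (fun x => Real.smoothTransition ((b a)⁻¹ * b (a + x)))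
      (deriv Real.smoothTransition ((b a)⁻¹ * b (a + x)) • ((b a)⁻¹ • fderiv ℝ b (a + x))) x := by
    intro x
    have h1 : HasFDerivAt (fun x => b (a + x)) (fderiv ℝ b (a + x)) x := by
      have h0 : HasFDerivAt (fun x => a + x) (ContinuousLinearMap.id ℝ E) x :=
        (hasFDerivAt_id x).const_add a
      have h2 := (hdb (a + x)).hasFDerivAt.comp x h0
      rwa [ContinuousLinearMap.comp_id] at h2
    exact (hdS _).hasDerivAt.comp_hasFDerivAt x (h1.const_mul _)
  refine ⟨fun x => Real.smoothTransition ((b a)⁻¹ * b (a + x)), D * (|b a|⁻¹ * K), r,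
    fun x => (hd x).differentiableAt, fun x => ?_, fun x => Real.smoothTransition.nonneg _,
    fun x => Real.smoothTransition.le_one _, ?_, hr0, fun x hx => ?_⟩
  · have h1 : (b a)⁻¹ * b (a + x) ∈ Set.Icc (-M) M := by
      rw [Set.mem_Icc, ← abs_le, abs_mul, abs_inv, hM, div_eq_inv_mul]
      gcongr
      exact hbound _
    have h2 := hD _ h1
    rw [(hd x).fderiv, norm_smul, norm_smul, norm_inv, Real.norm_eq_abs (b a)]
    have h3 := norm_fderiv_le_of_lipschitz ℝ hK (x₀ := a + x)
    have h4 := (norm_nonneg _).trans h2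
    gcongr
  · simp [ha0]
  · have : b (a + x) = 0 := by
      by_contra hne
      have h1 := hr (show a + x ∈ Function.support b from hne)
      rw [Metric.mem_ball, dist_eq_norm, add_sub_cancel_left] at h1
      linarith
    simp [this]

namespace IsNormalizedBump

variable {E : Type*} [NormedAddCommGroup E] [NormedSpace ℝ E] {b : E → ℝ} {L R : ℝ}

theorem bound_nonneg (hb : IsNormalizedBump b L R) : 0 ≤ L :=
  (norm_nonneg _).trans (hb.norm_fderiv_le 0)

theorem prod {F : Type*} [NormedAddCommGroup F] [NormedSpace ℝ F] {c : F → ℝ} {L' : ℝ}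
    (hb : IsNormalizedBump b L R) (hc : IsNormalizedBump c L' R) :
    IsNormalizedBump (fun p : E × F => b p.1 * c p.2) (L + L') R := by
  have hd : ∀ p : E × F, HasFDerivAt (fun p : E × F => b p.1 * c p.2)
      (b p.1 • (fderiv ℝ c p.2).comp (ContinuousLinearMap.snd ℝ E F) +
        c p.2 • (fderiv ℝ b p.1).comp (ContinuousLinearMap.fst ℝ E F)) p := fun p =>
    ((hb.differentiable p.1).hasFDerivAt.comp p hasFDerivAt_fst).mul
      ((hc.differentiable p.2).hasFDerivAt.comp p hasFDerivAt_snd)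
  refine ⟨fun p => (hd p).differentiableAt, fun p => ?_, fun p => ?_, fun p => ?_, ?_,
    hb.radius_pos, fun p hp => ?_⟩
  · rw [(hd p).fderiv]
    have h1 : ‖b p.1 • (fderiv ℝ c p.2).comp (ContinuousLinearMap.snd ℝ E F)‖ ≤ 1 * (L' * 1) := by
      rw [norm_smul, Real.norm_of_nonneg (hb.nonneg _)]
      have := hc.bound_nonneg
      refine mul_le_mul (hb.le_one _) ((ContinuousLinearMap.opNorm_comp_le _ _).trans ?_)
        (norm_nonneg _) zero_le_one
      gcongr
      · exact hc.norm_fderiv_le _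
      · exact ContinuousLinearMap.norm_snd_le ..
    have h2 : ‖c p.2 • (fderiv ℝ b p.1).comp (ContinuousLinearMap.fst ℝ E F)‖ ≤ 1 * (L * 1) := by
      rw [norm_smul, Real.norm_of_nonneg (hc.nonneg _)]
      have := hb.bound_nonneg
      refine mul_le_mul (hc.le_one _) ((ContinuousLinearMap.opNorm_comp_le _ _).trans ?_)
        (norm_nonneg _) zero_le_one
      gcongr
      · exact hb.norm_fderiv_le _
      · exact ContinuousLinearMap.norm_fst_le ..
    linarith [norm_add_le (b p.1 • (fderiv ℝ c p.2).comp (ContinuousLinearMap.snd ℝ E F))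
      (c p.2 • (fderiv ℝ b p.1).comp (ContinuousLinearMap.fst ℝ E F))]
  · exact mul_nonneg (hb.nonneg _) (hc.nonneg _)
  · exact mul_le_one₀ (hb.le_one _) (hc.nonneg _) (hc.le_one _)
  · simp [hb.map_zero, hc.map_zero]
  · rcases le_max_iff.1 (hp.trans_eq (Prod.norm_def p)) with h | h
    · simp [hb.eq_zero _ h]
    · simp [hc.eq_zero _ h]

theorem hasFDerivAt_comp_smul_sub (hb : IsNormalizedBump b L R) (s : ℝ) (a x : E) :
    HasFDerivAt (fun x => b (s • (x - a))) (s • fderiv ℝ b (s • (x - a))) x := by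
  have h₀ : HasFDerivAt (fun x : E => s • (x - a)) (s • ContinuousLinearMap.id ℝ E) x :=
    ((hasFDerivAt_id x).sub_const a).const_smul s
  have h := (hb.differentiable (s • (x - a))).hasFDerivAt.comp x h₀
  rwa [ContinuousLinearMap.comp_smul, ContinuousLinearMap.comp_id] at h

end IsNormalizedBump

/-- Iterative choice of almost minimizers: at each step an almost minimizer of the current function
is selected and a scaled bump centred at it is subtracted. -/
theorem exists_almost_minimizing_seq {E : Type*} [NormedAddCommGroup E] [NormedSpace ℝ E]
    {b : E → ℝ} {L R : ℝ} (hb : IsNormalizedBump b L R) {S : Set E} (hne : S.Nonempty)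
    {f : E → ℝ} {A : ℝ} (hA : ∀ y ∈ S, A ≤ f y) {h s : ℕ → ℝ} (hh : ∀ n, 0 < h n) :
    ∃ x : ℕ → E, ∀ n, x n ∈ S ∧ ∀ y ∈ S,
      f (x n) - ∑ k ∈ Finset.range n, h k * b (s k • (x n - x k)) ≤
        f y - ∑ k ∈ Finset.range n, h k * b (s k • (y - x k)) + h n / 2 := by
  have hpick : ∀ (φ : E → ℝ) (σ : ℝ), ∃ x, (∃ B, ∀ y ∈ S, B ≤ φ y) → 0 < σ →
      x ∈ S ∧ ∀ y ∈ S, φ x ≤ φ y + σ := by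
    intro φ σ
    by_cases H : (∃ B, ∀ y ∈ S, B ≤ φ y) ∧ 0 < σ
    · obtain ⟨⟨B, hB⟩, hσ⟩ := H
      have hbdd : BddBelow (φ '' S) := ⟨B, by rintro _ ⟨y, hy, rfl⟩; exact hB y hy⟩
      obtain ⟨_, ⟨x, hx, rfl⟩, hlt⟩ :=
        exists_lt_of_csInf_lt (hne.image φ) (lt_add_of_pos_right (sInf (φ '' S)) hσ)
      refine ⟨x, fun _ _ => ⟨hx, fun y hy => ?_⟩⟩
      linarith [csInf_le hbdd (Set.mem_image_of_mem φ hy)]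
    · exact ⟨0, fun h1 h2 => absurd ⟨h1, h2⟩ H⟩
  choose pick hpick using hpick
  let φ : ℕ → E → ℝ := fun n => Nat.rec f
    (fun n ψ => fun y => ψ y - h n * b (s n • (y - pick ψ (h n / 2)))) n
  have hφ : ∀ n y, φ n y =
      f y - ∑ k ∈ Finset.range n, h k * b (s k • (y - pick (φ k) (h k / 2))) := by
    intro n
    induction n with
    | zero => intro y; simp [φ]
    | succ n ih =>
      intro y
      rw [Finset.sum_range_succ, ← sub_sub, ← ih y]
  refine ⟨fun n => pick (φ n) (h n / 2), fun n => ?_⟩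
  have hlow : ∃ B, ∀ y ∈ S, B ≤ φ n y := by
    refine ⟨A - ∑ k ∈ Finset.range n, h k, fun y hy => ?_⟩
    rw [hφ]
    refine sub_le_sub (hA y hy) (Finset.sum_le_sum fun k _ => ?_)
    exact mul_le_of_le_one_right (hh k).le (hb.le_one _)
  obtain ⟨h1, h2⟩ := hpick (φ n) (h n / 2) hlow (half_pos (hh n))
  refine ⟨h1, fun y hy => ?_⟩
  rw [← hφ, ← hφ]
  exact h2 y hy

/-- A lower semicontinuous function which, for every `n`, exceeds some of its values on `S` by
`δ n > 0` away from a ball of radius `ρ n → 0` attains a strong minimum on `S`. -/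
theorem exists_strong_min_of_separated {E : Type*} [NormedAddCommGroup E] [CompleteSpace E]
    {S : Set E} (hS : IsClosed S) {ψ : E → ℝ} (hψ : LowerSemicontinuous ψ)
    {A : ℝ} (hA : ∀ y ∈ S, A ≤ ψ y) {x : ℕ → E} {ρ δ : ℕ → ℝ} (hx : ∀ n, x n ∈ S)
    (hρ : Tendsto ρ atTop (𝓝 0)) (hδ : Tendsto δ atTop (𝓝 0)) (hδ0 : ∀ n, 0 < δ n)
    (hanti : Antitone δ)
    (hsep : ∀ n, ∀ y ∈ S, ρ n ≤ ‖y - x n‖ → ψ (x n) + δ n ≤ ψ y) :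
    ∃ z ∈ S, (∀ y ∈ S, ψ z ≤ ψ y) ∧
      ∀ r > 0, ∃ σ > 0, ∀ y ∈ S, r ≤ ‖y - z‖ → ψ z + σ ≤ ψ y := by
  have hne : (ψ '' S).Nonempty := ⟨_, x 0, hx 0, rfl⟩
  have hbdd : BddBelow (ψ '' S) := ⟨A, by rintro _ ⟨y, hy, rfl⟩; exact hA y hy⟩
  set m := sInf (ψ '' S)
  have hm : ∀ y ∈ S, m ≤ ψ y := fun y hy => csInf_le hbdd (Set.mem_image_of_mem ψ hy)
  have hclose : ∀ n, ∀ y ∈ S, ψ y < m + δ n → ‖y - x n‖ < ρ n := by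
    intro n y hy hlt
    by_contra! hcon
    linarith [hsep n y hy hcon, hm _ (hx n)]
  have hex : ∀ n, ∃ y ∈ S, ψ y < m + δ n := by
    intro n
    obtain ⟨_, ⟨y, hy, rfl⟩, hlt⟩ := exists_lt_of_csInf_lt hne (lt_add_of_pos_right m (hδ0 n))
    exact ⟨y, hy, hlt⟩
  choose w hwS hw using hex
  have hcauchy : CauchySeq w := by
    refine cauchySeq_of_le_tendsto_0' (fun n => 2 * ρ n) (fun n k hnk => ?_)
      (by simpa using hρ.const_mul 2)
    have h1 := hclose n (w n) (hwS n) (hw n)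
    have h2 := hclose n (w k) (hwS k) ((hw k).trans_le (by linarith [hanti hnk]))
    have h3 := dist_triangle_right (w n) (w k) (x n)
    rw [dist_eq_norm (w n) (x n), dist_eq_norm (w k) (x n)] at h3
    linarith
  obtain ⟨z, hz⟩ := cauchySeq_tendsto_of_complete hcauchy
  have hzS : z ∈ S := hS.mem_of_tendsto hz (Eventually.of_forall hwS)
  have hzm : ψ z ≤ m := by
    refine le_of_forall_lt fun c hc => ?_
    obtain ⟨c', hcc', hc'⟩ := exists_between hc
    refine hcc'.trans_le (ge_of_tendsto (by simpa using hδ.const_add m) ?_)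
    filter_upwards [hz.eventually (hψ z c' hc')] with n hn
    exact (hn.trans (hw n)).le
  refine ⟨z, hzS, fun y hy => hzm.trans (hm y hy), fun r hr => ?_⟩
  obtain ⟨n, hn⟩ := (hρ.eventually (gt_mem_nhds (half_pos hr))).exists
  refine ⟨δ n, hδ0 n, fun y hy hry => ?_⟩
  by_contra! hcon
  have h1 := hclose n y hy (by linarith)
  have h2 := hclose n z hzS (by linarith [hδ0 n])
  have h3 := norm_sub_le_norm_sub_add_norm_sub y (x n) z
  rw [norm_sub_rev (x n) z] at h3
  linarith

/-- The smooth variational principle: a lower semicontinuous function bounded below on a closed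
set attains a strong minimum after an arbitrarily small smooth perturbation. -/
theorem exists_perturbation_strong_min {E : Type*} [NormedAddCommGroup E] [NormedSpace ℝ E]
    [CompleteSpace E] {b : E → ℝ} {L R : ℝ} (hb : IsNormalizedBump b L R) {S : Set E}
    (hS : IsClosed S) (hne : S.Nonempty) {f : E → ℝ} (hf : LowerSemicontinuous f) {A : ℝ}
    (hA : ∀ y ∈ S, A ≤ f y) {ε : ℝ} (hε : 0 < ε) :
    ∃ g : E → ℝ, Differentiable ℝ g ∧ (∀ x, |g x| ≤ ε) ∧ (∀ x, ‖fderiv ℝ g x‖ ≤ ε) ∧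
      ∃ z ∈ S, (∀ y ∈ S, f z + g z ≤ f y + g y) ∧
        ∀ r > 0, ∃ σ > 0, ∀ y ∈ S, r ≤ ‖y - z‖ → f z + g z + σ ≤ f y + g y := by
  have hL := hb.bound_nonneg
  set c := ε / (2 * (L + 1)) with hc
  have hc0 : 0 < c := by positivity
  have hcε : 2 * (c * L) + 2 * c = ε := by rw [hc]; field_simp
  set h : ℕ → ℝ := fun n => c * (1 / 4) ^ n with hh
  set s : ℕ → ℝ := fun n => 2 ^ n with hs
  have hpos : ∀ n, 0 < h n := fun n => by positivity
  have hhsum : HasSum h (c * (4 / 3)) := by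
    have := (hasSum_geometric_of_lt_one (r := (1 / 4 : ℝ)) (by norm_num) (by norm_num)).mul_left c
    norm_num at this
    simpa [hh] using this
  obtain ⟨x, hx⟩ := exists_almost_minimizing_seq hb hne hA (s := s) hpos
  set t : ℕ → E → ℝ := fun k y => h k * b (s k • (y - x k)) with ht
  have ht0 : ∀ k y, 0 ≤ t k y := fun k y => mul_nonneg (hpos k).le (hb.nonneg _)
  have hth : ∀ k y, t k y ≤ h k := fun k y => mul_le_of_le_one_right (hpos k).le (hb.le_one _)
  have htsum : ∀ y, Summable fun k => t k y := fun y =>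
    Summable.of_nonneg_of_le (fun k => ht0 k y) (fun k => hth k y) hhsum.summable
  have hderiv : ∀ k y, HasFDerivAt (t k) (h k • (s k • fderiv ℝ b (s k • (y - x k)))) y :=
    fun k y => (hb.hasFDerivAt_comp_smul_sub _ _ _).const_mul _
  have hbound : ∀ k y, ‖h k • (s k • fderiv ℝ b (s k • (y - x k)))‖ ≤ c * L * (1 / 2) ^ k := by
    intro k y
    have h1 : h k * s k = c * (1 / 2) ^ k := by
      simp only [hh, hs]
      rw [mul_assoc, ← mul_pow]
      norm_num
    rw [smul_smul, h1, norm_smul, Real.norm_of_nonneg (by positivity)]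
    have := hb.norm_fderiv_le (s k • (y - x k))
    calc c * (1 / 2) ^ k * ‖fderiv ℝ b (s k • (y - x k))‖ ≤ c * (1 / 2) ^ k * L := by gcongr
      _ = c * L * (1 / 2) ^ k := by ring
  have hgeo : HasSum (fun k : ℕ => c * L * (1 / 2) ^ k) (c * L * 2) :=
    hasSum_geometric_two.mul_left _
  have hT : ∀ y, HasFDerivAt (fun y => ∑' k, t k y)
      (∑' k, h k • (s k • fderiv ℝ b (s k • (y - x k)))) y := fun y =>
    hasFDerivAt_tsum hgeo.summable hderiv hbound (htsum 0) y
  have hT0 : ∀ y, 0 ≤ ∑' k, t k y := fun y => tsum_nonneg fun k => ht0 k y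
  have hT1 : ∀ y, ∑' k, t k y ≤ c * (4 / 3) := fun y =>
    ((htsum y).tsum_le_tsum (fun k => hth k y) hhsum.summable).trans_eq hhsum.tsum_eq
  have hneg : ∀ y, HasFDerivAt (fun y => -∑' k, t k y)
      (-∑' k, h k • (s k • fderiv ℝ b (s k • (y - x k)))) y := fun y => (hT y).neg
  have hgd : Differentiable ℝ fun y => -∑' k, t k y := fun y => (hneg y).differentiableAt
  have hcL : 0 ≤ c * L := by positivity
  refine ⟨fun y => -∑' k, t k y, hgd, fun y => ?_, fun y => ?_, ?_⟩
  · rw [abs_neg, abs_of_nonneg (hT0 y)]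
    linarith [hT1 y]
  · rw [(hneg y).fderiv, norm_neg]
    refine (tsum_of_norm_bounded hgeo fun k => hbound k y).trans ?_
    linarith
  · refine exists_strong_min_of_separated (ψ := fun y => f y + -∑' k, t k y) (A := A - c * (4 / 3))
      (x := x) (ρ := fun n => R * (1 / 2) ^ n) (δ := fun n => h n / 6) hS
      (hf.add hgd.continuous.lowerSemicontinuous) (fun y hy => by linarith [hA y hy, hT1 y])
      (fun n => (hx n).1) ?_ ?_ (fun n => by linarith [hpos n]) ?_ fun n y hy hfar => ?_
    · simpa using (tendsto_pow_atTop_nhds_zero_of_lt_one (r := (1 / 2 : ℝ)) (by norm_num)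
        (by norm_num)).const_mul R
    · simpa using hhsum.summable.tendsto_atTop_zero.div_const 6
    · intro i j hij
      have : ((1 : ℝ) / 4) ^ j ≤ (1 / 4) ^ i :=
        pow_le_pow_of_le_one (by norm_num) (by norm_num) hij
      simp only [hh]
      gcongr
    · have h1 := (hx n).2 y hy
      have h2 : t n y = 0 := by
        simp only [ht]
        rw [hb.eq_zero, mul_zero]
        rw [norm_smul, hs, Real.norm_of_nonneg (by positivity)]
        calc R = 2 ^ n * (R * (1 / 2) ^ n) := by
              rw [mul_left_comm, ← mul_pow]; norm_num
          _ ≤ 2 ^ n * ‖y - x n‖ := by gcongr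
      have h3 : t n (x n) = h n := by simp [ht, hb.map_zero]
      have h4 : ∑' k, t (k + (n + 1)) y ≤ h n / 3 := by
        have hs' : HasSum (fun k => h (k + (n + 1))) (h n / 3) := by
          have := (hasSum_geometric_of_lt_one (r := (1 / 4 : ℝ)) (by norm_num)
            (by norm_num)).mul_left (h n / 4)
          rw [show h n / 3 = h n / 4 * (1 - 1 / 4)⁻¹ by ring,
            show (fun k => h (k + (n + 1))) = fun k => h n / 4 * (1 / 4) ^ k by
              ext k; simp only [hh]; ring]
          exact this
        exact (((summable_nat_add_iff (n + 1)).2 (htsum y)).tsum_le_tsum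
          (fun k => hth _ y) hs'.summable).trans_eq hs'.tsum_eq
      have h5 := (htsum y).sum_add_tsum_nat_add (n + 1)
      have h6 := (htsum (x n)).sum_le_tsum (Finset.range (n + 1)) fun k _ => ht0 k (x n)
      rw [Finset.sum_range_succ, h2] at h5
      rw [Finset.sum_range_succ, h3] at h6
      simp only [ht] at h1 h4 h5 h6 ⊢
      linarith

theorem neg_mem_subdiff_of_mem_superdiff_neg {f : X → ℝ} {x : X} {Δ : X →L[ℝ] ℝ}
    (h : Δ ∈ superdiff (fun y => -f y) x) : -Δ ∈ subdiff f x := by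
  intro ε hε
  obtain ⟨δ, hδ, H⟩ := h ε hε
  refine ⟨δ, hδ, fun w hw => ?_⟩
  have := H w hw
  rw [neg_apply]
  linarith

theorem neg_mem_superdiff_of_mem_subdiff_neg {f : X → ℝ} {x : X} {Δ : X →L[ℝ] ℝ}
    (h : Δ ∈ subdiff (fun y => -f y) x) : -Δ ∈ superdiff f x := by
  intro ε hε
  obtain ⟨δ, hδ, H⟩ := h ε hε
  refine ⟨δ, hδ, fun w hw => ?_⟩
  have := H w hw
  rw [neg_apply]
  linarith

theorem mem_superdiff_of_eventually_le {u φ : X → ℝ} {p : X →L[ℝ] ℝ} {x : X}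
    (hφ : HasFDerivAt φ p x) (hmin : ∀ᶠ y in 𝓝 x, φ x - u x ≤ φ y - u y) :
    p ∈ superdiff u x := by
  intro ε hε
  have h1 := Asymptotics.isLittleO_iff.1 (hasFDerivAt_iff_isLittleO.1 hφ) hε
  obtain ⟨δ, hδ, H⟩ := Metric.eventually_nhds_iff.1 (h1.and hmin)
  refine ⟨δ, hδ, fun w hw => ?_⟩
  obtain ⟨h2, h3⟩ := H (y := x + w) (by simpa [dist_eq_norm] using hw)
  rw [add_sub_cancel_left, Real.norm_eq_abs] at h2
  linarith [(abs_le.1 h2).2]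

theorem neg_mem_subdiff_of_eventually_le {v φ : X → ℝ} {p : X →L[ℝ] ℝ} {x : X}
    (hφ : HasFDerivAt φ p x) (hmin : ∀ᶠ y in 𝓝 x, φ x + v x ≤ φ y + v y) :
    -p ∈ subdiff v x :=
  neg_mem_subdiff_of_mem_superdiff_neg (mem_superdiff_of_eventually_le hφ (by simpa using hmin))

theorem norm_le_of_mem_superdiff {u : X → ℝ} {x : X} {p : X →L[ℝ] ℝ} (hp : p ∈ superdiff u x)
    {U : Set X} (hU : U ∈ 𝓝 x) {K : NNReal} (hK : LipschitzOnWith K u U) : ‖p‖ ≤ K + 1 := by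
  obtain ⟨δ, hδ, H⟩ := hp 1 one_pos
  obtain ⟨r, hr, hrU⟩ := Metric.mem_nhds_iff.1 hU
  have hle : ∀ w : X, ‖w‖ < min δ r → p w ≤ (K + 1) * ‖w‖ := by
    intro w hw
    have h1 := H (-w) (by rw [norm_neg]; exact hw.trans_le (min_le_left _ _))
    have h2 := hK.dist_le_mul _ (mem_of_mem_nhds hU) (x + -w)
      (hrU (by simpa [dist_eq_norm] using hw.trans_le (min_le_right _ _)))
    rw [Real.dist_eq, dist_eq_norm, sub_add_cancel_left, neg_neg] at h2
    rw [map_neg, norm_neg] at h1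
    linarith [(abs_le.1 h2).2]
  refine ContinuousLinearMap.opNorm_le_of_ball (lt_min hδ hr) (by positivity) fun w hw => ?_
  rw [mem_ball_zero_iff] at hw
  rw [Real.norm_eq_abs, abs_le]
  have h1 := hle (-w) (by rwa [norm_neg])
  rw [map_neg, norm_neg] at h1
  exact ⟨by linarith, hle w hw⟩

/-- Fuzzy sum rule at a strong minimum `z` of `v - u + g`, where `u` is Lipschitz near `z`. -/
theorem exists_mem_superdiff_mem_subdiff [CompleteSpace X] {b : X → ℝ} {L R : ℝ}
    (hb : IsNormalizedBump b L R) {u v g : X → ℝ} (husc : UpperSemicontinuous u)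
    (hvlsc : LowerSemicontinuous v) {A B : ℝ} (hu : ∀ x, |u x| ≤ A) (hv : ∀ x, |v x| ≤ B)
    {ε : ℝ} (hgd : Differentiable ℝ g) (hg : ∀ x, |g x| ≤ ε) (hg' : ∀ x, ‖fderiv ℝ g x‖ ≤ ε)
    {z : X} (hz : ∀ r > 0, ∃ σ > 0, ∀ y, r ≤ ‖y - z‖ →
      v z - u z + g z + σ ≤ v y - u y + g y)
    {U : Set X} (hU : U ∈ 𝓝 z) {K : NNReal} (hK : LipschitzOnWith K u U) {η : ℝ} (hη : 0 < η) :
    ∃ x y, ∃ p ∈ superdiff u x, ∃ q ∈ subdiff v y,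
      ‖x - y‖ ≤ η ∧ ‖p - q‖ ≤ ε + η ∧ ‖p‖ ≤ K + 1 ∧ v y - u x ≤ v z - u z + 2 * ε + η := by
  obtain ⟨r, hr, hrU⟩ := Metric.nhds_basis_closedBall.mem_iff.1 hU
  obtain ⟨σ, hσ, hsep⟩ := hz (r / 2) (half_pos hr)
  obtain ⟨θ, hθ, hθη, hθσ⟩ : ∃ θ > 0, θ ≤ η / 2 ∧ θ ≤ σ / 8 :=
    ⟨min (η / 2) (σ / 8), by positivity, min_le_left _ _, min_le_right _ _⟩
  obtain ⟨d, hd, hdr, hdη, hdσ⟩ : ∃ d > 0, d ≤ r / 2 ∧ d ≤ η ∧ K * d ≤ σ / 2 := by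
    refine ⟨min (min (r / 2) η) (σ / (2 * (K + 1))), by positivity,
      (min_le_left _ _).trans (min_le_left _ _), (min_le_left _ _).trans (min_le_right _ _), ?_⟩
    calc K * min (min (r / 2) η) (σ / (2 * (K + 1))) ≤ (K + 1) * (σ / (2 * (K + 1))) := by
          gcongr
          · linarith
          · exact min_le_right _ _
      _ = σ / 2 := by field_simp
  have hR := hb.radius_pos
  set M := 2 * (A + B + ε) + 2 * θ + 1 with hM
  have hM0 : 0 ≤ M := by
    linarith [(abs_nonneg _).trans (hu z), (abs_nonneg _).trans (hv z), (abs_nonneg _).trans (hg z)]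
  set P : X → ℝ := fun w => M * (1 - b ((R / d) • w)) with hP
  have hP0 : ∀ w, 0 ≤ P w := fun w => mul_nonneg hM0 (sub_nonneg.2 (hb.le_one _))
  have hPzero : P 0 = 0 := by simp [hP, hb.map_zero]
  have hPfar : ∀ w, d ≤ ‖w‖ → P w = M := by
    intro w hw
    have : b ((R / d) • w) = 0 := by
      apply hb.eq_zero
      rw [norm_smul, Real.norm_of_nonneg (by positivity)]
      calc R = R / d * d := by field_simp
        _ ≤ R / d * ‖w‖ := by gcongr
    simp [hP, this]
  have hPd : Differentiable ℝ P :=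
    (((hb.differentiable.comp (differentiable_id.const_smul (R / d))).const_sub 1)).const_mul M
  set F : X × X → ℝ := fun w => v w.2 + -u w.1 + (g w.2 + P (w.1 - w.2)) with hF
  have hFlsc : LowerSemicontinuous F := by
    refine ((hvlsc.comp continuous_snd).add (g := fun w : X × X => -u w.1) ?_).add
      (Continuous.lowerSemicontinuous ?_)
    · intro w c hc
      have := (husc.comp continuous_fst) w (-c) (by simp only [Function.comp]; linarith)
      filter_upwards [this] with w' hw'
      simp only [Function.comp] at hw'
      linarith
    · exact (hgd.continuous.comp continuous_snd).add
        (hPd.continuous.comp (continuous_fst.sub continuous_snd))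
  have hFlow : ∀ w ∈ Metric.closedBall (z, z) r, -(A + B + ε) ≤ F w := by
    intro w _
    simp only [hF]
    linarith [(abs_le.1 (hu w.1)).2, (abs_le.1 (hv w.2)).1, (abs_le.1 (hg w.2)).1, hP0 (w.1 - w.2)]
  obtain ⟨G, hGd, hG, hG', ⟨x, y⟩, hxyS, hmin, -⟩ := exists_perturbation_strong_min (hb.prod hb)
    Metric.isClosed_closedBall ⟨(z, z), Metric.mem_closedBall_self hr.le⟩ hFlsc hFlow hθ
  have hFz : F (z, z) = v z - u z + g z := by simp [hF, hPzero, sub_eq_add_neg]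
  have hFxy : F (x, y) = v y - u x + g y + P (x - y) := by simp only [hF]; ring
  have hle : v y - u x + g y + P (x - y) ≤ v z - u z + g z + 2 * θ := by
    linarith [hmin (z, z) (Metric.mem_closedBall_self hr.le),
      (abs_le.1 (hG (x, y))).1, (abs_le.1 (hG (z, z))).2]
  have hxy : ‖x - y‖ < d := by
    by_contra! hcon
    rw [hPfar _ hcon] at hle
    linarith [(abs_le.1 (hu x)).2, (abs_le.1 (hv y)).1, (abs_le.1 (hg y)).1,
      (abs_le.1 (hu z)).1, (abs_le.1 (hv z)).2, (abs_le.1 (hg z)).2]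
  have hPxy := hP0 (x - y)
  have hyz : ‖y - z‖ < r / 2 := by
    by_contra! hcon
    rw [← closedBall_prod_same] at hxyS
    have h1 := hK.dist_le_mul x (hrU hxyS.1) y (hrU hxyS.2)
    rw [Real.dist_eq, dist_eq_norm] at h1
    have h2 : (K : ℝ) * ‖x - y‖ ≤ K * d := by gcongr
    linarith [hsep y hcon, (abs_le.1 h1).2]
  have hxz : ‖x - z‖ < r := by
    linarith [norm_sub_le_norm_sub_add_norm_sub x y z]
  have hball : Metric.closedBall (z, z) r ∈ 𝓝 (x, y) := by
    rw [← closedBall_prod_same]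
    refine prod_mem_nhds ?_ ?_ <;> refine Filter.mem_of_superset (Metric.isOpen_ball.mem_nhds ?_)
      Metric.ball_subset_closedBall
    · rwa [mem_ball_iff_norm]
    · rw [mem_ball_iff_norm]; linarith
  have hUx : U ∈ 𝓝 x := Filter.mem_of_superset
    (Metric.isOpen_ball.mem_nhds (mem_ball_iff_norm.2 hxz)) (Metric.ball_subset_closedBall.trans hrU)
  have hGxy := (hGd (x, y)).hasFDerivAt
  set Q := fderiv ℝ P (x - y)
  set D := fderiv ℝ G (x, y)
  have hPx : HasFDerivAt (fun x' => P (x' - y)) Q x := by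
    have h0 : HasFDerivAt (fun x' => x' - y) (ContinuousLinearMap.id ℝ X) x :=
      (hasFDerivAt_id x).sub_const y
    have h1 := (hPd (x - y)).hasFDerivAt.comp x h0
    rwa [ContinuousLinearMap.comp_id] at h1
  have hPy : HasFDerivAt (fun y' => P (x - y')) (-Q) y := by
    have h0 : HasFDerivAt (fun y' => x - y') (-ContinuousLinearMap.id ℝ X) y :=
      (hasFDerivAt_id y).const_sub x
    have h1 := (hPd (x - y)).hasFDerivAt.comp y h0
    rwa [ContinuousLinearMap.comp_neg, ContinuousLinearMap.comp_id] at h1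
  have hφ : HasFDerivAt (fun x' => P (x' - y) + G (x', y))
      (Q + D.comp (ContinuousLinearMap.inl ℝ X X)) x :=
    hPx.add (hGxy.comp x (hasFDerivAt_prodMk_left x y))
  have hχ : HasFDerivAt (fun y' => g y' + P (x - y') + G (x, y'))
      (fderiv ℝ g y + -Q + D.comp (ContinuousLinearMap.inr ℝ X X)) y :=
    ((hgd y).hasFDerivAt.add hPy).add (hGxy.comp y (hasFDerivAt_prodMk_right x y))
  have hp := mem_superdiff_of_eventually_le (u := u) hφ (by
    filter_upwards [(Continuous.prodMk_left y).continuousAt.preimage_mem_nhds hball] with x' hx'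
    have := hmin (x', y) hx'
    simp only [hF] at this
    linarith)
  have hq := neg_mem_subdiff_of_eventually_le (v := v) hχ (by
    filter_upwards [(Continuous.prodMk_right x).continuousAt.preimage_mem_nhds hball] with y' hy'
    have := hmin (x, y') hy'
    simp only [hF] at this
    linarith)
  have hDl : ‖D.comp (ContinuousLinearMap.inl ℝ X X)‖ ≤ θ * 1 :=
    (ContinuousLinearMap.opNorm_comp_le _ _).trans (mul_le_mul (hG' _)
      (ContinuousLinearMap.norm_inl_le_one ..) (norm_nonneg _) hθ.le)
  have hDr : ‖D.comp (ContinuousLinearMap.inr ℝ X X)‖ ≤ θ * 1 :=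
    (ContinuousLinearMap.opNorm_comp_le _ _).trans (mul_le_mul (hG' _)
      (ContinuousLinearMap.norm_inr_le_one ..) (norm_nonneg _) hθ.le)
  refine ⟨x, y, _, hp, _, hq, hxy.le.trans hdη, ?_, norm_le_of_mem_superdiff hp hUx hK, ?_⟩
  · have heq : Q + D.comp (ContinuousLinearMap.inl ℝ X X) -
        -(fderiv ℝ g y + -Q + D.comp (ContinuousLinearMap.inr ℝ X X)) =
        fderiv ℝ g y + D.comp (ContinuousLinearMap.inl ℝ X X) +
          D.comp (ContinuousLinearMap.inr ℝ X X) := by abel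
    rw [heq]
    refine norm_add₃_le.trans ?_
    linarith [hg' y]
  · linarith [(abs_le.1 (hg y)).1, (abs_le.1 (hg z)).2]

/-- At a strong minimum of `v - u + g`, with `g` a small perturbation and `u` Lipschitz nearby, the
subsolution `u` exceeds the supersolution `v` by at most a small amount. -/
theorem sub_le_of_strong_min [CompleteSpace X] {b : X → ℝ} {L R : ℝ}
    (hb : IsNormalizedBump b L R) {H : X → ℝ → ℝ} {C : ℝ} {ω : ℝ → ℝ → ℝ} (hC : 0 ≤ C)
    (hH : ∀ (x₁ x₂ : X) (t₁ t₂ : ℝ),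
      |H x₁ t₁ - H x₂ t₂| ≤ ω ‖x₁ - x₂‖ (t₁ - t₂) + C * max |t₁| |t₂| * ‖x₁ - x₂‖)
    {u v g : X → ℝ} (husc : UpperSemicontinuous u) (hvlsc : LowerSemicontinuous v) {A B : ℝ}
    (hu : ∀ x, |u x| ≤ A) (hv : ∀ x, |v x| ≤ B)
    (husub : ∀ x : X, ∀ Δ ∈ superdiff u x, u x + H x ‖Δ‖ ≤ 0)
    (hvsuper : ∀ x : X, ∀ Δ ∈ subdiff v x, 0 ≤ v x + H x ‖Δ‖)
    {κ τ : ℝ} (hκ : 0 < κ) (hτ : 0 < τ) (hω : ∀ s t, |s| ≤ κ → |t| ≤ κ → ω s t ≤ τ)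
    {ε : ℝ} (hεκ : ε ≤ κ / 2) (hgd : Differentiable ℝ g) (hg : ∀ x, |g x| ≤ ε)
    (hg' : ∀ x, ‖fderiv ℝ g x‖ ≤ ε)
    {z : X} (hz : ∀ r > 0, ∃ σ > 0, ∀ y, r ≤ ‖y - z‖ →
      v z - u z + g z + σ ≤ v y - u y + g y)
    {U : Set X} (hU : U ∈ 𝓝 z) {K : NNReal} (hK : LipschitzOnWith K u U) :
    u z - v z ≤ 2 * ε + 3 * τ := by
  obtain ⟨η, hη, hηκ, hητ, hηC⟩ : ∃ η > 0, η ≤ κ / 2 ∧ η ≤ τ ∧ C * (K + 1 + κ) * η ≤ τ := by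
    refine ⟨min (min (κ / 2) τ) (τ / (C * (K + 1 + κ) + 1)), by positivity,
      (min_le_left _ _).trans (min_le_left _ _), (min_le_left _ _).trans (min_le_right _ _), ?_⟩
    calc C * (K + 1 + κ) * min (min (κ / 2) τ) (τ / (C * (K + 1 + κ) + 1))
        ≤ (C * (K + 1 + κ) + 1) * (τ / (C * (K + 1 + κ) + 1)) := by
          gcongr
          · linarith
          · exact min_le_right _ _
      _ = τ := by field_simp
  obtain ⟨x, y, p, hp, q, hq, hxy, hpq, hpK, hval⟩ :=
    exists_mem_superdiff_mem_subdiff hb husc hvlsc hu hv hgd hg hg' hz hU hK hη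
  have h1 := husub x p hp
  have h2 := hvsuper y q hq
  have h3 := hH y x ‖q‖ ‖p‖
  have h4 := abs_norm_sub_norm_le q p
  rw [norm_sub_rev] at h4
  rw [abs_norm, abs_norm, norm_sub_rev] at h3
  have h5 := hω ‖x - y‖ (‖q‖ - ‖p‖) (by rw [abs_norm]; linarith) (by linarith)
  have h6 : C * max ‖q‖ ‖p‖ * ‖x - y‖ ≤ C * (K + 1 + κ) * η := by
    gcongr
    exact max_le (by linarith [(abs_le.1 h4).2]) (by linarith)
  linarith [(abs_le.1 h3).2]

theorem stmt12 [CompleteSpace X] (hbump : HasC1LipBump X)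
    (H : X → ℝ → ℝ) (hHcont : Continuous (fun p : X × ℝ => H p.1 p.2))
    (hHA : CondA H)
    (u v : X → ℝ)
    (husc : UpperSemicontinuous u) (hvlsc : LowerSemicontinuous v)
    (hubdd : ∃ C : ℝ, ∀ x, |u x| ≤ C) (hvbdd : ∃ C : ℝ, ∀ x, |v x| ≤ C)
    (husub : ∀ x : X, ∀ Δ ∈ superdiff u x, u x + H x ‖Δ‖ ≤ 0)
    (hvsuper : ∀ x : X, ∀ Δ ∈ subdiff v x, 0 ≤ v x + H x ‖Δ‖)
    (hLip : ∀ x : X, (∃ U ∈ 𝓝 x, ∃ K : NNReal, LipschitzOnWith K u U) ∨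
      (∃ U ∈ 𝓝 x, ∃ K : NNReal, LipschitzOnWith K v U)) :
    ∀ x : X, u x ≤ v x := by
  obtain ⟨b, L, R, hb⟩ := hbump.exists_isNormalizedBump
  obtain ⟨A, hu⟩ := hubdd
  obtain ⟨B, hv⟩ := hvbdd
  obtain ⟨C, ω, hC, hωc, hω0, hH⟩ := hHA
  have hnegu : LowerSemicontinuous fun x => -u x := by
    intro x c hc
    filter_upwards [husc x (-c) (by linarith)] with y hy
    linarith
  have hnegv : UpperSemicontinuous fun x => -v x := by
    intro x c hc
    filter_upwards [hvlsc x (-c) (by linarith)] with y hy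
    linarith
  intro w
  by_contra! hlt
  set τ := (u w - v w) / 8 with hτ
  have hτ0 : 0 < τ := by rw [hτ]; linarith
  obtain ⟨κ, hκ, hω⟩ : ∃ κ > 0, ∀ s t, |s| ≤ κ → |t| ≤ κ → ω s t ≤ τ := by
    have h1 : ∀ᶠ p : ℝ × ℝ in 𝓝 (0, 0), ω p.1 p.2 < τ :=
      hωc.continuousAt.eventually (gt_mem_nhds (by simpa [hω0] using hτ0))
    obtain ⟨κ, hκ, hκ'⟩ := Metric.nhds_basis_closedBall.mem_iff.1 h1
    refine ⟨κ, hκ, fun s t hs ht => le_of_lt (hκ' (a := (s, t)) ?_)⟩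
    rw [← closedBall_prod_same]
    exact ⟨by simpa using hs, by simpa using ht⟩
  set ε := min (κ / 2) τ
  have hε : 0 < ε := by positivity
  have hεκ : ε ≤ κ / 2 := min_le_left _ _
  have hετ : ε ≤ τ := min_le_right _ _
  obtain ⟨g, hgd, hg, hg', z, -, hmin, hstrong⟩ := exists_perturbation_strong_min hb isClosed_univ
    ⟨w, trivial⟩ (hvlsc.add hnegu) (A := -(A + B))
    (fun y _ => by linarith [(abs_le.1 (hu y)).2, (abs_le.1 (hv y)).1]) hε
  have hwz := hmin w trivial
  have hz : u z - v z ≤ 2 * ε + 3 * τ := by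
    rcases hLip z with ⟨U, hU, K, hK⟩ | ⟨U, hU, K, hK⟩
    · refine sub_le_of_strong_min hb hC hH husc hvlsc hu hv husub hvsuper hκ hτ0 hω hεκ hgd hg hg'
        (fun r hr => ?_) hU hK
      obtain ⟨σ, hσ, h⟩ := hstrong r hr
      exact ⟨σ, hσ, fun y hy => by linarith [h y trivial hy]⟩
    · have := sub_le_of_strong_min hb (H := fun x t => -H x t) (u := fun x => -v x)
        (v := fun x => -u x) (A := B) (B := A) (z := z) hC
        (fun x₁ x₂ t₁ t₂ => by
          rw [← abs_neg, show -(-H x₁ t₁ - -H x₂ t₂) = H x₁ t₁ - H x₂ t₂ by ring]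
          exact hH x₁ x₂ t₁ t₂)
        hnegv hnegu (fun x => by rw [abs_neg]; exact hv x) (fun x => by rw [abs_neg]; exact hu x)
        (fun x Δ hΔ => by
          have := hvsuper x _ (neg_mem_subdiff_of_mem_superdiff_neg hΔ)
          rw [norm_neg] at this
          linarith)
        (fun x Δ hΔ => by
          have := husub x _ (neg_mem_superdiff_of_mem_subdiff_neg hΔ)
          rw [norm_neg] at this
          linarith)
        hκ hτ0 hω hεκ hgd hg hg'
        (fun r hr => by
          obtain ⟨σ, hσ, h⟩ := hstrong r hr
          exact ⟨σ, hσ, fun y hy => by linarith [h y trivial hy]⟩)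
        hU (K := K) hK.neg
      linarith
  linarith [(abs_le.1 (hg w)).2, (abs_le.1 (hg z)).1]
end

section
/- Let X be a real Banach space admitting a C¹ Lipschitz bump function, let Ω ⊆ X be open, and let F : Ω × X* × ℝ → ℝ be continuous. Let 𝓕 be a nonempty, locally uniformly bounded family of upper semicontinuous functions v : Ω → ℝ, each of which is a viscosity subsolution of F(x, du(x), u(x)) = 0 on Ω, i.e. F(x, Δ, v(x)) ≤ 0 for every x ∈ Ω and every Δ ∈ D⁺v(x). Let u = sup{v : v ∈ 𝓕} on Ω. Then the upper semicontinuous envelope u* is also a viscosity subsolution of F(x, du(x), u(x)) = 0 on Ω, i.e. F(x, Δ, u*(x)) ≤ 0 for every x ∈ Ω and every Δ ∈ D⁺u*(x). -/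
open Filter Topology

variable {X : Type*} [NormedAddCommGroup X] [NormedSpace ℝ X]

/-- The upper semicontinuous envelope on `Ω` of `u : Ω → ℝ`:
`u*(x) = lim_{r→0⁺} sup_{y ∈ B(x,r) ∩ Ω} u(y)`. -/
noncomputable def uscEnv (Ω : Set X) (u : X → ℝ) (x : X) : ℝ :=
  Filter.limsup u (𝓝[Ω] x)

/-- A `C¹` Lipschitz bump function can be rescaled to a nonnegative bounded one, with bounded
derivative, equal to `1` at the origin and vanishing off the open unit ball. -/
theorem HasC1LipBump.exists_normalized (hbump : HasC1LipBump X) :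
    ∃ (φ : X → ℝ) (C : ℝ), Differentiable ℝ φ ∧ (∀ x, 0 ≤ φ x) ∧ φ 0 = 1 ∧
      (∀ x, 1 ≤ ‖x‖ → φ x = 0) ∧ (∀ x, φ x ≤ C) ∧ ∀ x, ‖fderiv ℝ φ x‖ ≤ C := by
  obtain ⟨b, hb, ⟨K, hK⟩, hbd, z, hz⟩ := hbump
  obtain ⟨R, hR, hRsub⟩ := hbd.subset_ball_lt 0 z
  have hz' : b z ≠ 0 := hz
  have hzsq : 0 < b z ^ 2 := by positivity
  have hout : ∀ y, R ≤ dist y z → b y = 0 := by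
    intro y hy
    by_contra hne
    exact absurd (Metric.mem_ball.1 (hRsub hne)) (not_lt.2 hy)
  have hK0 : (0 : ℝ) ≤ K := K.coe_nonneg
  set B : ℝ := |b z| + K * R with hB
  have hB0 : 0 ≤ B := by positivity
  have hbB : ∀ y, |b y| ≤ B := by
    intro y
    rcases le_or_gt R (dist y z) with h | h
    · rw [hout y h, abs_zero]; exact hB0
    · have h1 := hK.dist_le_mul y z
      rw [Real.dist_eq] at h1
      have h2 := abs_sub_abs_le_abs_sub (b y) (b z)
      have h3 : (K : ℝ) * dist y z ≤ K * R := by gcongr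
      linarith
  set φ : X → ℝ := fun x => b (z + R • x) ^ 2 / b z ^ 2 with hφ
  set L : ℝ := 2 * B * (K * R) / b z ^ 2 with hL
  have hL0 : 0 ≤ L := by positivity
  have hlip : LipschitzWith L.toNNReal φ := by
    refine LipschitzWith.of_dist_le_mul fun x y => ?_
    rw [Real.coe_toNNReal _ hL0, Real.dist_eq]
    have h1 := hK.dist_le_mul (z + R • x) (z + R • y)
    rw [Real.dist_eq, dist_add_left, dist_smul₀, Real.norm_of_nonneg hR.le] at h1
    have h2 : |b (z + R • x) + b (z + R • y)| ≤ 2 * B := by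
      have := abs_add_le (b (z + R • x)) (b (z + R • y))
      linarith [hbB (z + R • x), hbB (z + R • y)]
    have h3 : φ x - φ y =
        (b (z + R • x) + b (z + R • y)) * (b (z + R • x) - b (z + R • y)) / b z ^ 2 := by
      simp only [hφ]; ring
    rw [h3, abs_div, abs_mul, abs_of_pos hzsq, hL, div_mul_eq_mul_div]
    refine div_le_div_of_nonneg_right ?_ hzsq.le
    calc _ ≤ 2 * B * (K * (R * dist x y)) :=
          mul_le_mul h2 h1 (abs_nonneg _) (by positivity)
      _ = _ := by ring
  refine ⟨φ, max L (B ^ 2 / b z ^ 2), ?_, fun x => by positivity, by simp [hφ, hz'], ?_, ?_, ?_⟩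
  · have := hb.differentiable one_ne_zero
    simp only [hφ]
    fun_prop
  · intro x hx
    have : b (z + R • x) = 0 := by
      refine hout _ ?_
      rw [dist_eq_norm, add_sub_cancel_left, norm_smul, Real.norm_of_nonneg hR.le]
      nlinarith
    simp [hφ, this]
  · intro x
    refine le_max_of_le_right ?_
    simp only [hφ]
    gcongr ?_ / _
    exact sq_le_sq' (neg_le_of_abs_le (hbB _)) (le_of_abs_le (hbB _))
  · intro x
    refine le_max_of_le_left ?_
    simpa [hL0] using norm_fderiv_le_of_lipschitz ℝ hlip (x₀ := x)

/-- A function bounded above on `S` has, for every `δ > 0`, a `δ`-maximizer on `S` at which it is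
at least as large as at a prescribed point of `S`. -/
theorem exists_almost_max {α : Type*} {S : Set α} {H : α → ℝ} (hH : BddAbove (H '' S))
    {p : α} (hp : p ∈ S) {δ : ℝ} (hδ : 0 < δ) : ∃ q ∈ S, H p ≤ H q ∧ ∀ y ∈ S, H y < H q + δ := by
  obtain ⟨_, ⟨q, hq, rfl⟩, hlt⟩ :=
    exists_lt_of_lt_csSup (Set.Nonempty.image H ⟨p, hp⟩) (sub_lt_self (sSup (H '' S)) hδ)
  have hle : ∀ y ∈ S, H y ≤ sSup (H '' S) := fun y hy => le_csSup hH ⟨y, hy, rfl⟩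
  rcases le_total (H p) (H q) with h | h
  · exact ⟨q, hq, h, fun y hy => by linarith [hle y hy]⟩
  · exact ⟨p, hp, le_rfl, fun y hy => by linarith [hle y hy]⟩

/-- Localized Deville–Godefroy–Zizler variational principle: an upper semicontinuous function on a
closed set, almost maximal at `x₁`, attains its maximum at a point near `x₁` after adding a small
differentiable perturbation with small derivative. -/
theorem exists_perturbed_max [CompleteSpace X] {φ : X → ℝ} {C : ℝ} (hφd : Differentiable ℝ φ)
    (hφ0 : ∀ x, 0 ≤ φ x) (hφ1 : φ 0 = 1) (hφout : ∀ x, 1 ≤ ‖x‖ → φ x = 0)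
    (hφC : ∀ x, φ x ≤ C) (hφ' : ∀ x, ‖fderiv ℝ φ x‖ ≤ C)
    {S : Set X} (hS : IsClosed S) {G : X → ℝ} (hG : UpperSemicontinuousOn G S)
    {x₁ : X} (hx₁ : x₁ ∈ S) {ε r : ℝ} (hε : 0 < ε) (hr : 0 < r)
    (hmax : ∀ y ∈ S, G y < G x₁ + ε) :
    ∃ x ∈ S, ∃ g : X → ℝ, dist x₁ x ≤ 2 * r ∧ Differentiable ℝ g ∧
      (∀ y, 0 ≤ g y) ∧ (∀ y, g y ≤ 2 * ε * C) ∧ (∀ y, ‖fderiv ℝ g y‖ ≤ 2 * ε * C / r) ∧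
      ∀ y ∈ S, G y + g y ≤ G x + g x := by
  have hC : 1 ≤ C := hφ1 ▸ hφC 0
  have hpick : ∀ (H : X → ℝ) (p : X) (δ : ℝ), ∃ q, BddAbove (H '' S) → p ∈ S → 0 < δ →
      q ∈ S ∧ H p ≤ H q ∧ ∀ y ∈ S, H y < H q + δ := by
    intro H p δ
    by_cases h : BddAbove (H '' S) ∧ p ∈ S ∧ 0 < δ
    · obtain ⟨q, hq⟩ := exists_almost_max h.1 h.2.1 h.2.2
      exact ⟨q, fun _ _ _ => hq⟩
    · exact ⟨p, fun h1 h2 h3 => absurd ⟨h1, h2, h3⟩ h⟩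
  choose pick hpick using hpick
  let e : ℕ → ℝ := fun n => ε / 4 ^ n
  let ρ : ℕ → ℝ := fun n => r / 2 ^ n
  have he : ∀ n, 0 < e n := fun n => by positivity
  have hρ : ∀ n, 0 < ρ n := fun n => by positivity
  let step : ℕ → X → X → ℝ := fun n c y => e n * φ ((ρ n)⁻¹ • (y - c))
  let st : ℕ → X × (X → ℝ) := fun n => Nat.rec (x₁, G)
    (fun n s => (pick (fun y => s.2 y + step n s.1 y) s.1 (e (n + 1)),
      fun y => s.2 y + step n s.1 y)) n
  let x : ℕ → X := fun n => (st n).1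
  let H : ℕ → X → ℝ := fun n => (st n).2
  have hHs : ∀ n y, H (n + 1) y = H n y + step n (x n) y := fun n y => rfl
  have hxs : ∀ n, x (n + 1) = pick (H (n + 1)) (x n) (e (n + 1)) := fun n => rfl
  have hstep0 : ∀ n c y, 0 ≤ step n c y := fun n c y => mul_nonneg (he n).le (hφ0 _)
  have hstepC : ∀ n c y, step n c y ≤ e n * C := fun n c y =>
    mul_le_mul_of_nonneg_left (hφC _) (he n).le
  have hbdd : ∀ n, x n ∈ S → (∀ y ∈ S, H n y < H n (x n) + e n) → BddAbove (H (n + 1) '' S) := by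
    rintro n - h
    refine ⟨H n (x n) + e n + e n * C, ?_⟩
    rintro _ ⟨y, hy, rfl⟩
    rw [hHs]
    linarith [h y hy, hstepC n (x n) y]
  have hinv : ∀ n, x n ∈ S ∧ ∀ y ∈ S, H n y < H n (x n) + e n := by
    intro n
    induction n with
    | zero => exact ⟨hx₁, fun y hy => by simpa [e, H, x, st] using hmax y hy⟩
    | succ n ih =>
      have := hpick (H (n + 1)) (x n) (e (n + 1)) (hbdd n ih.1 ih.2) ih.1 (he _)
      rw [← hxs] at this
      exact ⟨this.1, this.2.2⟩
  have hmono : ∀ n, H (n + 1) (x n) ≤ H (n + 1) (x (n + 1)) := by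
    intro n
    have := hpick (H (n + 1)) (x n) (e (n + 1)) (hbdd n (hinv n).1 (hinv n).2) (hinv n).1 (he _)
    rw [← hxs] at this
    exact this.2.1
  have hdist : ∀ n, dist (x n) (x (n + 1)) ≤ 2 * r / 2 / 2 ^ n := by
    intro n
    by_contra! hlt
    have hlt' : ρ n < ‖x (n + 1) - x n‖ := by
      rw [← dist_eq_norm, dist_comm]
      simpa [ρ] using hlt
    have h0 : step n (x n) (x (n + 1)) = 0 := by
      have : φ ((ρ n)⁻¹ • (x (n + 1) - x n)) = 0 := by
        refine hφout _ ?_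
        rw [norm_smul, norm_inv, Real.norm_of_nonneg (hρ n).le, inv_mul_eq_div,
          one_le_div (hρ n)]
        exact hlt'.le
      simp only [step, this, mul_zero]
    have h1 : step n (x n) (x n) = e n := by simp [step, hφ1]
    have h2 := hmono n
    rw [hHs, hHs, h0, h1] at h2
    linarith [(hinv n).2 _ (hinv (n + 1)).1]
  obtain ⟨a, ha⟩ := cauchySeq_tendsto_of_complete (cauchySeq_of_le_geometric_two hdist)
  have haS : a ∈ S := hS.mem_of_tendsto ha (Eventually.of_forall fun n => (hinv n).1)
  have hd1 : dist x₁ a ≤ 2 * r := dist_le_of_le_geometric_two_of_tendsto₀ hdist ha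
  let f : ℕ → X → ℝ := fun n => step n (x n)
  have hf' : ∀ n y, HasFDerivAt (f n)
      (e n • ((fderiv ℝ φ ((ρ n)⁻¹ • (y - x n))).comp
        ((ρ n)⁻¹ • ContinuousLinearMap.id ℝ X))) y := by
    intro n y
    have h1 : HasFDerivAt (fun y => (ρ n)⁻¹ • (y - x n))
        ((ρ n)⁻¹ • ContinuousLinearMap.id ℝ X) y :=
      ((hasFDerivAt_id y).sub_const (x n)).const_smul (ρ n)⁻¹
    exact ((hφd _).hasFDerivAt.comp y h1).const_mul (e n)
  have hgeo (c : ℝ) : HasSum (fun n : ℕ => c * (1 / 2) ^ n) (2 * c) := by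
    simpa [mul_comm] using hasSum_geometric_two.mul_left c
  have heg : ∀ n, e n ≤ ε * (1 / 2) ^ n := by
    intro n
    have : ((1 : ℝ) / 4) ^ n ≤ (1 / 2) ^ n := by gcongr; norm_num
    calc e n = ε * (1 / 4) ^ n := by simp [e, div_eq_mul_inv]
      _ ≤ _ := by gcongr
  have hfn : ∀ n y, ‖f n y‖ ≤ ε * C * (1 / 2) ^ n := by
    intro n y
    rw [Real.norm_of_nonneg (hstep0 _ _ _)]
    calc f n y ≤ e n * C := hstepC _ _ _
      _ ≤ ε * (1 / 2) ^ n * C := by gcongr; exact heg n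
      _ = _ := by ring
  have hf'n : ∀ n y, ‖e n • ((fderiv ℝ φ ((ρ n)⁻¹ • (y - x n))).comp
        ((ρ n)⁻¹ • ContinuousLinearMap.id ℝ X))‖ ≤ ε * C / r * (1 / 2) ^ n := by
    intro n y
    have h1 : ‖(ρ n)⁻¹ • ContinuousLinearMap.id ℝ X‖ ≤ (ρ n)⁻¹ := by
      rw [norm_smul, norm_inv, Real.norm_of_nonneg (hρ n).le]
      exact mul_le_of_le_one_right (inv_nonneg.2 (hρ n).le) ContinuousLinearMap.norm_id_le
    have h2 := ContinuousLinearMap.opNorm_comp_le (fderiv ℝ φ ((ρ n)⁻¹ • (y - x n)))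
      ((ρ n)⁻¹ • ContinuousLinearMap.id ℝ X)
    rw [norm_smul, Real.norm_of_nonneg (he n).le]
    calc _ ≤ e n * (C * (ρ n)⁻¹) := by
          refine mul_le_mul_of_nonneg_left (h2.trans ?_) (he n).le
          exact mul_le_mul (hφ' _) h1 (norm_nonneg _) (by linarith)
      _ = ε * C / r * (1 / 2) ^ n := by
          have : (4 : ℝ) ^ n = 2 ^ n * 2 ^ n := by rw [← mul_pow]; norm_num
          simp only [e, ρ, this, one_div, inv_pow]
          field_simp
  have hsum : ∀ y, Summable fun n => f n y := fun y =>
    Summable.of_norm_bounded (hgeo (ε * C)).summable fun n => hfn n y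
  have hgd := fun y => hasFDerivAt_tsum (hgeo (ε * C / r)).summable hf' hf'n (hsum x₁) y
  have hHsum : ∀ n y, H n y = G y + ∑ k ∈ Finset.range n, f k y := by
    intro n y
    induction n with
    | zero => simp [H, st]
    | succ n ih => rw [hHs, ih, Finset.sum_range_succ, add_assoc]
  set g : X → ℝ := fun y => ∑' n, f n y with hg
  have hHle : ∀ n y, H n y ≤ G y + g y := by
    intro n y
    rw [hHsum]
    gcongr
    exact (hsum y).sum_le_tsum _ fun k _ => hstep0 _ _ _
  refine ⟨a, haS, g, hd1, fun y => (hgd y).differentiableAt, fun y => tsum_nonneg fun n =>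
    hstep0 _ _ _, fun y => ?_, fun y => ?_, fun y hy => ?_⟩
  · calc g y ≤ ‖g y‖ := le_abs_self _
      _ ≤ 2 * (ε * C) := tsum_of_norm_bounded (hgeo _) fun n => hfn n y
      _ = _ := by ring
  · rw [(hgd y).fderiv]
    calc _ ≤ 2 * (ε * C / r) := tsum_of_norm_bounded (hgeo _) fun n => hf'n n y
      _ = _ := by ring
  · refine le_of_forall_gt_imp_ge_of_dense fun t ht => ?_
    have hgc : Continuous g := continuous_iff_continuousAt.2 fun y => (hgd y).continuousAt
    have husc : UpperSemicontinuousOn (fun y => G y + g y) S :=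
      hG.add (hgc.upperSemicontinuous.upperSemicontinuousOn S)
    have hev : ∀ᶠ n in atTop, G (x n) + g (x n) < t :=
      (tendsto_nhdsWithin_iff.2 ⟨ha, Eventually.of_forall fun n => (hinv n).1⟩).eventually
        (husc a haS t ht)
    have hH : Tendsto (fun n => H n y) atTop (𝓝 (G y + g y)) := by
      simp only [hHsum]
      exact (hsum y).hasSum.tendsto_sum_nat.const_add _
    have h0 : Tendsto (fun n : ℕ => t + ε * (1 / 2) ^ n) atTop (𝓝 t) := by
      simpa using (hgeo ε).summable.tendsto_atTop_zero.const_add t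
    refine le_of_tendsto_of_tendsto hH h0 ?_
    filter_upwards [hev] with n hn
    linarith [(hinv n).2 y hy, hHle n (x n), heg n]

/-- If `f - g` has a local maximum at `x` with `g` differentiable at `x`, then the derivative of
`g` at `x` belongs to the superdifferential of `f` at `x`. -/
theorem mem_superdiffOn_of_local_max {Ω : Set X} {f g : X → ℝ} {x : X} {Δ : X →L[ℝ] ℝ}
    (hg : HasFDerivAt g Δ x) (hmax : ∀ᶠ y in 𝓝[Ω] x, f y - g y ≤ f x - g x) :
    Δ ∈ superdiffOn Ω f x := by
  intro ε hε
  have h1 := (hasFDerivAt_iff_isLittleO_nhds_zero.1 hg).def hε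
  obtain ⟨δ₁, hδ₁, h1⟩ := Metric.eventually_nhds_iff.1 h1
  obtain ⟨δ₂, hδ₂, h2⟩ := Metric.eventually_nhds_iff.1 (eventually_nhdsWithin_iff.1 hmax)
  refine ⟨min δ₁ δ₂, lt_min hδ₁ hδ₂, fun h hh hΩ => ?_⟩
  have h3 := h1 (y := h) (by simpa using hh.trans_le (min_le_left _ _))
  have h4 := h2 (y := x + h) (by simpa [dist_eq_norm] using hh.trans_le (min_le_right _ _)) hΩ
  linarith [le_of_abs_le h3]

/-- A function bounded above near `x ∈ Ω` lies below its upper semicontinuous envelope at `x`. -/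
theorem le_uscEnv {Y : Type*} [NormedAddCommGroup Y] {Ω : Set Y} {u : Y → ℝ} {x : Y}
    (hx : x ∈ Ω) (hu : IsBoundedUnder (· ≤ ·) (𝓝[Ω] x) u) : u x ≤ uscEnv Ω u x := by
  refine le_limsup_of_frequently_le (fun h => ?_) hu
  exact h.self_of_nhdsWithin hx le_rfl

theorem stmt14 [CompleteSpace X] (hbump : HasC1LipBump X)
    (Ω : Set X) (hΩopen : IsOpen Ω)
    (F : X → (X →L[ℝ] ℝ) → ℝ → ℝ)
    (hFcont : ContinuousOn (fun p : X × (X →L[ℝ] ℝ) × ℝ => F p.1 p.2.1 p.2.2)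
      {p : X × (X →L[ℝ] ℝ) × ℝ | p.1 ∈ Ω})
    (𝓕 : Set (X → ℝ)) (h𝓕ne : 𝓕.Nonempty)
    (husc : ∀ v ∈ 𝓕, UpperSemicontinuousOn v Ω)
    (hbdd : ∀ x ∈ Ω, ∃ U ∈ 𝓝 x, ∃ C : ℝ, ∀ v ∈ 𝓕, ∀ y ∈ U ∩ Ω, |v y| ≤ C)
    (hsub : ∀ v ∈ 𝓕, ∀ x ∈ Ω, ∀ Δ ∈ superdiffOn Ω v x, F x Δ (v x) ≤ 0)
    (u : X → ℝ) (hu : ∀ y ∈ Ω, IsLUB ((fun v : X → ℝ => v y) '' 𝓕) (u y)) :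
    ∀ x ∈ Ω, ∀ Δ ∈ superdiffOn Ω (uscEnv Ω u) x, F x Δ (uscEnv Ω u x) ≤ 0 := by
  intro x₀ hx₀ Δ hΔ
  obtain ⟨φ, C, hφd, hφ0, hφ1, hφout, hφC, hφ'⟩ := hbump.exists_normalized
  have hC : 1 ≤ C := hφ1 ▸ hφC 0
  have hvu : ∀ v ∈ 𝓕, ∀ y ∈ Ω, v y ≤ u y := fun v hv y hy => (hu y hy).1 ⟨v, hv, rfl⟩
  have hubd : ∀ y ∈ Ω, ∃ B : ℝ, ∀ᶠ z in 𝓝[Ω] y, -B ≤ u z ∧ u z ≤ B := by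
    intro y hy
    obtain ⟨U, hU, B, hB⟩ := hbdd y hy
    refine ⟨B, ?_⟩
    filter_upwards [mem_nhdsWithin_of_mem_nhds hU, self_mem_nhdsWithin] with z hzU hzΩ
    obtain ⟨v, hv⟩ := h𝓕ne
    refine ⟨(neg_le_of_abs_le (hB v hv z ⟨hzU, hzΩ⟩)).trans (hvu v hv z hzΩ), ?_⟩
    refine (hu z hzΩ).2 ?_
    rintro _ ⟨w, hw, rfl⟩
    exact le_of_abs_le (hB w hw z ⟨hzU, hzΩ⟩)
  have hle : ∀ y ∈ Ω, u y ≤ uscEnv Ω u y := by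
    intro y hy
    obtain ⟨B, hB⟩ := hubd y hy
    exact le_uscEnv hy ⟨B, by simpa using hB.mono fun z hz => hz.2⟩
  set a := uscEnv Ω u x₀ with ha
  have hfreq : ∀ c < a, ∃ᶠ z in 𝓝[Ω] x₀, c < u z := by
    intro c hc
    obtain ⟨B, hB⟩ := hubd x₀ hx₀
    have : (𝓝[Ω] x₀).NeBot := by
      rw [hΩopen.nhdsWithin_eq hx₀]; infer_instance
    exact frequently_lt_of_lt_limsup
      (IsCoboundedUnder.of_frequently_ge (hB.mono fun z hz => hz.1).frequently) hc
  by_contra! hF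
  have hFev := (hFcont (x₀, Δ, a) hx₀).eventually (lt_mem_nhds hF)
  obtain ⟨ρ, hρ, hFρ⟩ := Metric.eventually_nhds_iff.1 (eventually_nhdsWithin_iff.1 hFev)
  set η : ℝ := ρ / (64 * C) with hη
  have hη0 : 0 < η := by positivity
  have hηC : 64 * (η * C) = ρ := by rw [hη]; field_simp
  have hηle : 64 * η ≤ ρ := by nlinarith
  obtain ⟨δ, hδ, hΔδ⟩ := hΔ η hη0
  obtain ⟨R, hR, hRΩ⟩ := Metric.isOpen_iff.1 hΩopen x₀ hx₀
  obtain ⟨r, hr, hrδ, hrR, hr1, hrρ, hrΔ⟩ : ∃ r > 0, r < δ ∧ r < R ∧ r < 1 ∧ r < ρ ∧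
      ‖Δ‖ * r < ρ / 4 := by
    have hc : Tendsto (fun r : ℝ => ‖Δ‖ * r) (𝓝[>] 0) (𝓝 0) := by
      have : Continuous fun r : ℝ => ‖Δ‖ * r := by fun_prop
      exact (this.tendsto' 0 0 (mul_zero _)).mono_left nhdsWithin_le_nhds
    have h {s : ℝ} (hs : 0 < s) : ∀ᶠ t in 𝓝[>] (0 : ℝ), t ∈ Set.Ioo 0 s := Ioo_mem_nhdsGT hs
    obtain ⟨r, h1, h2, h3, h4, h5⟩ := ((h hδ).and ((h hR).and ((h one_pos).and ((h hρ).and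
      (hc.eventually (gt_mem_nhds (show (0 : ℝ) < ρ / 4 by positivity))))))).exists
    exact ⟨r, h1.1, h1.2, h2.2, h3.2, h4.2, h5⟩
  have hSΩ : Metric.closedBall x₀ r ⊆ Ω :=
    (Metric.closedBall_subset_ball hrR).trans hRΩ
  have hη1 : η * r ≤ η := mul_le_of_le_one_right hη0.le hr1.le
  have hup : ∀ v ∈ 𝓕, ∀ y ∈ Metric.closedBall x₀ r, v y ≤ a + Δ (y - x₀) + η * r := by
    intro v hv y hy
    have hn : ‖y - x₀‖ ≤ r := by rwa [← dist_eq_norm]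
    have h1 := hΔδ (y - x₀) (hn.trans_lt hrδ) (by simpa using hSΩ hy)
    rw [add_sub_cancel] at h1
    have h2 : η * ‖y - x₀‖ ≤ η * r := by gcongr
    linarith [hvu v hv y (hSΩ hy), hle y (hSΩ hy)]
  obtain ⟨y₁, hy₁u, hy₁r, hy₁Δ⟩ : ∃ y₁, a - η * r / 2 < u y₁ ∧ dist y₁ x₀ < r / 4 ∧
      Δ (y₁ - x₀) < η * r / 4 := by
    have hc : Tendsto (fun y => Δ (y - x₀)) (𝓝 x₀) (𝓝 0) :=
      (Δ.continuous.comp (continuous_id.sub continuous_const)).tendsto' _ _ (by simp)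
    have h1 := hc.eventually (gt_mem_nhds (show (0 : ℝ) < η * r / 4 by positivity))
    have h2 := Metric.ball_mem_nhds x₀ (show 0 < r / 4 by positivity)
    have h3 := hfreq (a - η * r / 2) (sub_lt_self _ (by positivity))
    exact (h3.and_eventually (mem_nhdsWithin_of_mem_nhds (inter_mem h2 h1))).exists
  have hy₁S : y₁ ∈ Metric.closedBall x₀ r := by
    rw [Metric.mem_closedBall]; linarith
  obtain ⟨_, ⟨v, hv, rfl⟩, hvy₁⟩ := (lt_isLUB_iff (hu y₁ (hSΩ hy₁S))).1 hy₁u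
  let G : X → ℝ := fun y => v y + -Δ (y - x₀)
  have hGusc : UpperSemicontinuousOn G (Metric.closedBall x₀ r) := by
    refine UpperSemicontinuousOn.add ((husc v hv).mono hSΩ) ?_
    have : Continuous fun y => -Δ (y - x₀) := by fun_prop
    exact this.upperSemicontinuous.upperSemicontinuousOn _
  have hηr : 0 < η * r := by positivity
  obtain ⟨x, hxS, g, hdx, hgd, hg0, hgC, hg', hmax⟩ :=
    exists_perturbed_max hφd hφ0 hφ1 hφout hφC hφ' Metric.isClosed_closedBall hGusc hy₁S
      (show 0 < 2 * (η * r) by positivity) (show 0 < r / 4 by positivity) (fun y hy => by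
        simp only [G]
        linarith [hup v hv y hy])
  have hxd : dist x x₀ < r := by
    have := dist_triangle x y₁ x₀
    rw [dist_comm x y₁] at this
    linarith
  have hmem : Δ - fderiv ℝ g x ∈ superdiffOn Ω v x := by
    have hd : HasFDerivAt (fun y => Δ (y - x₀) - g y) (Δ - fderiv ℝ g x) x := by
      have h1 : HasFDerivAt (fun y => Δ (y - x₀)) Δ x :=
        Δ.hasFDerivAt.comp x ((hasFDerivAt_id x).sub_const x₀)
      exact h1.sub (hgd x).hasFDerivAt
    refine mem_superdiffOn_of_local_max hd (mem_nhdsWithin_of_mem_nhds ?_)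
    filter_upwards [Metric.isOpen_ball.mem_nhds (Metric.mem_ball.2 hxd)] with y hy
    have := hmax y (Metric.ball_subset_closedBall hy)
    simp only [G] at this
    linarith
  have hFle := hsub v hv x (hSΩ hxS) _ hmem
  have hΔx : |Δ (x - x₀)| ≤ ‖Δ‖ * r := by
    refine (Δ.le_opNorm _).trans ?_
    rw [← dist_eq_norm]
    gcongr
  have hslope : ‖fderiv ℝ g x‖ ≤ ρ / 4 := by
    refine (hg' x).trans (le_of_eq ?_)
    rw [← hηC]
    field_simp
    ring
  have hval : |v x - a| < ρ := by
    have h1 := hup v hv x hxS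
    have h2 := hmax y₁ hy₁S
    simp only [G] at h2
    have h3 : 2 * (2 * (η * r)) * C ≤ 4 * (η * C) := by nlinarith
    have h4 := abs_le.1 hΔx
    rw [abs_lt]
    constructor <;> linarith [hg0 y₁, hgC x]
  refine absurd hFle (not_le.2 (hFρ (y := (x, Δ - fderiv ℝ g x, v x)) ?_ (hSΩ hxS)))
  rw [Prod.dist_eq, Prod.dist_eq]
  refine max_lt (hxd.trans hrρ) (max_lt ?_ hval)
  rw [dist_eq_norm]
  simp only [sub_sub_cancel_left, norm_neg]
  linarith
end

section
/- Let X be a real Banach space admitting a C¹ Lipschitz bump function, let Ω ⊆ X be open, and let F : Ω × X* × ℝ → ℝ be continuous. Suppose s₀, s₁ : Ω → ℝ are continuous, s₀ ≤ s₁ on Ω, s₀ is a viscosity subsolution and s₁ is a viscosity supersolution of F(x, du(x), u(x)) = 0 on Ω. Let 𝓕 = {w : Ω → ℝ : s₀ ≤ w ≤ s₁ on Ω and w is a viscosity subsolution of F(x, du(x), u(x)) = 0 on Ω} and u = sup 𝓕. Then u* is a viscosity subsolution of F = 0 on Ω, (u*)_* is a viscosity supersolution of F = 0 on Ω, and s₀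 ≤ (u*)_* ≤ u* ≤ s₁ on Ω. -/
open Filter Topology

variable {X : Type*} [NormedAddCommGroup X] [NormedSpace ℝ X]

/-- `w` is a viscosity subsolution of `F(x, du(x), u(x)) = 0` on `Ω`. -/
def IsSubsolOn (Ω : Set X) (F : X → (X →L[ℝ] ℝ) → ℝ → ℝ) (w : X → ℝ) : Prop :=
  UpperSemicontinuousOn w Ω ∧ ∀ x ∈ Ω, ∀ Δ ∈ superdiffOn Ω w x, F x Δ (w x) ≤ 0

/-- `w` is a viscosity supersolution of `F(x, du(x), u(x)) = 0` on `Ω`. -/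
def IsSupersolOn (Ω : Set X) (F : X → (X →L[ℝ] ℝ) → ℝ → ℝ) (w : X → ℝ) : Prop :=
  LowerSemicontinuousOn w Ω ∧ ∀ x ∈ Ω, ∀ Δ ∈ subdiffOn Ω w x, 0 ≤ F x Δ (w x)

/-- The lower semicontinuous envelope on `Ω`. -/
noncomputable def lscEnv (Ω : Set X) (u : X → ℝ) (x : X) : ℝ :=
  Filter.liminf u (𝓝[Ω] x)

/-- A family of bumps `β r c` equal to `1` at the center `c`, vanishing outside the ball of radius
`r` around `c`, with derivative `β' r c` bounded by `K / r`. -/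
structure IsBumpFamily (K : ℝ) (β : ℝ → X → X → ℝ) (β' : ℝ → X → X → X →L[ℝ] ℝ) : Prop where
  hasFDerivAt : ∀ r > 0, ∀ c y, HasFDerivAt (β r c) (β' r c y) y
  norm_le : ∀ r > 0, ∀ c y, ‖β' r c y‖ ≤ K / r
  nonneg : ∀ r c y, 0 ≤ β r c y
  le_one : ∀ r c y, β r c y ≤ 1
  center : ∀ r c, β r c c = 1
  eq_zero : ∀ r > 0, ∀ c y, r ≤ ‖y - c‖ → β r c y = 0

theorem HasC1LipBump.exists_isBumpFamily (h : HasC1LipBump X) :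
    ∃ K : ℝ, 0 ≤ K ∧ ∃ β β', IsBumpFamily (X := X) K β β' := by
  obtain ⟨b, hb, ⟨C, hC⟩, hbdd, x₀, hx₀⟩ := h
  have hx₀ : b x₀ ≠ 0 := hx₀
  obtain ⟨R, hR, hsupp⟩ := hbdd.subset_ball_lt 0 x₀
  have hd : Differentiable ℝ b := hb.differentiable (by simp)
  set a : ℝ := Real.pi / 2 / b x₀ with ha
  -- composing with `sin ^ 2` makes the bump take values in `[0, 1]`
  refine ⟨R * (|a| * C), by positivity,
    fun r c y => Real.sin (a * b (x₀ + (R / r) • (y - c))) ^ 2,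
    fun r c y => (2 * Real.sin (a * b (x₀ + (R / r) • (y - c))) *
      Real.cos (a * b (x₀ + (R / r) • (y - c))) * a * (R / r)) •
        fderiv ℝ b (x₀ + (R / r) • (y - c)), ?_, ?_, ?_, ?_, ?_, ?_⟩
  · intro r hr c y
    have h1 : HasFDerivAt (fun y => x₀ + (R / r) • (y - c))
        ((R / r) • ContinuousLinearMap.id ℝ X) y :=
      (((hasFDerivAt_id y).sub_const c).const_smul (R / r)).const_add x₀
    have h2 := ((hd (x₀ + (R / r) • (y - c))).hasFDerivAt.comp y h1).const_mul a
    refine (h2.sin.pow 2).congr_fderiv ?_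
    ext v
    simp
    ring
  · intro r hr c y
    set s := a * b (x₀ + (R / r) • (y - c))
    have h1 : ‖fderiv ℝ b (x₀ + (R / r) • (y - c))‖ ≤ C := norm_fderiv_le_of_lipschitz ℝ hC
    have h2 : |2 * Real.sin s * Real.cos s| ≤ 1 := by
      rw [← Real.sin_two_mul]; exact Real.abs_sin_le_one _
    have h3 : |R / r| = R / r := abs_of_pos (by positivity)
    rw [norm_smul, Real.norm_eq_abs, abs_mul, abs_mul _ a, h3]
    calc |2 * Real.sin s * Real.cos s| * |a| * (R / r) * _
        ≤ 1 * |a| * (R / r) * C := by gcongr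
      _ = _ := by ring
  · intro r c y; positivity
  · intro r c y; exact Real.sin_sq_le_one _
  · intro r c
    have : a * b x₀ = Real.pi / 2 := by rw [ha]; field_simp
    simp [this]
  · intro r hr c y hy
    have : b (x₀ + (R / r) • (y - c)) = 0 := by
      by_contra hne
      have h1 := hsupp hne
      rw [mem_ball_iff_norm, add_sub_cancel_left, norm_smul, Real.norm_eq_abs,
        abs_of_pos (by positivity)] at h1
      have : R / r * r ≤ R / r * ‖y - c‖ := by gcongr
      rw [div_mul_cancel₀ _ hr.ne'] at this
      linarith
    simp [this]

/-- A smooth variational principle: an upper semicontinuous function bounded above on a closed set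
attains its maximum after a small differentiable perturbation. -/
theorem IsBumpFamily.exists_perturbed_max [CompleteSpace X] {K : ℝ} (hK : 0 ≤ K)
    {β : ℝ → X → X → ℝ} {β' : ℝ → X → X → X →L[ℝ] ℝ} (hβ : IsBumpFamily K β β')
    {D : Set X} (hD : IsClosed D) (hne : D.Nonempty) {g : X → ℝ}
    (hg : UpperSemicontinuousOn g D) {M : ℝ} (hM : ∀ y ∈ D, g y ≤ M) {κ : ℝ} (hκ : 0 < κ) :
    ∃ p : X → ℝ, ∃ p' : X → X →L[ℝ] ℝ, (∀ y, HasFDerivAt p (p' y) y) ∧ (∀ y, ‖p' y‖ ≤ κ) ∧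
      (∀ y, 0 ≤ p y) ∧ (∀ y, p y ≤ κ) ∧ ∃ y ∈ D, ∀ z ∈ D, g z + p z ≤ g y + p y := by
  set c : ℕ → ℝ := fun n => κ / (2 * (K + 1)) * (1 / 8) ^ n with hc
  set r : ℕ → ℝ := fun n => (1 / 2) ^ n with hr
  have hc0 : ∀ n, 0 < c n := fun n => by simp only [hc]; positivity
  have hr0 : ∀ n, 0 < r n := fun n => by simp only [hr]; positivity
  have hcs : ∀ n, c (n + 1) = c n / 8 := fun n => by simp only [hc, pow_succ]; ring
  have hpick : ∀ (n : ℕ) (q : X → ℝ), ∃ x ∈ D, (∃ N, ∀ y, q y ≤ N) →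
      ∀ y ∈ D, g y + q y ≤ g x + q x + c n / 2 := by
    intro n q
    by_cases hq : ∃ N, ∀ y, q y ≤ N
    · obtain ⟨N, hN⟩ := hq
      have hb : BddAbove ((fun y => g y + q y) '' D) := by
        refine ⟨M + N, ?_⟩
        rintro _ ⟨y, hy, rfl⟩
        exact add_le_add (hM y hy) (hN y)
      obtain ⟨_, ⟨x, hx, rfl⟩, hlt⟩ := exists_lt_of_lt_csSup (hne.image _)
        (sub_lt_self (sSup ((fun y => g y + q y) '' D)) (half_pos (hc0 n)))
      refine ⟨x, hx, fun _ y hy => ?_⟩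
      have := le_csSup hb ⟨y, hy, rfl⟩
      simp only at this hlt
      linarith
    · exact ⟨hne.some, hne.some_mem, fun h => absurd h hq⟩
  choose pick hpickD hpick using hpick
  let P : ℕ → X → ℝ := fun n => Nat.rec (fun _ => 0)
    (fun n q y => q y + c n * β (r n) (pick n q) y) n
  let x : ℕ → X := fun n => pick n (P n)
  let t : ℕ → X → ℝ := fun n y => c n * β (r n) (x n) y
  have hPs : ∀ n y, P (n + 1) y = P n y + t n y := fun n y => rfl
  have hxD : ∀ n, x n ∈ D := fun n => hpickD n _
  have ht0 : ∀ n y, 0 ≤ t n y := fun n y => mul_nonneg (hc0 n).le (hβ.nonneg _ _ _)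
  have ht1 : ∀ n y, t n y ≤ c n := fun n y =>
    mul_le_of_le_one_right (hc0 n).le (hβ.le_one _ _ _)
  have hPmono : ∀ y, Monotone fun n => P n y := fun y =>
    monotone_nat_of_le_succ fun n => by rw [hPs]; linarith [ht0 n y]
  have hPanti : ∀ y, Antitone fun n => P n y + 8 / 7 * c n := fun y =>
    antitone_nat_of_succ_le fun n => by rw [hPs, hcs]; linarith [ht1 n y]
  have hxmax : ∀ n, ∀ y ∈ D, g y + P n y ≤ g (x n) + P n (x n) + c n / 2 := fun n =>
    hpick n (P n) ⟨P 0 0 + 8 / 7 * c 0, fun y => by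
      have := hPanti y (Nat.zero_le n)
      have h0 : P 0 y = P 0 0 := rfl
      simp only [h0] at this
      linarith [hc0 n]⟩
  have hdist : ∀ n, ‖x (n + 1) - x n‖ < r n := by
    intro n
    by_contra! hcon
    have h1 := hxmax n (x (n + 1)) (hxD _)
    have h2 := hxmax (n + 1) (x n) (hxD _)
    have h3 : t n (x (n + 1)) = 0 := by simp only [t]; rw [hβ.eq_zero _ (hr0 n) _ _ hcon, mul_zero]
    have h4 : t n (x n) = c n := by simp only [t]; rw [hβ.center, mul_one]
    rw [hPs, hPs, h3, h4, hcs] at h2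
    linarith [hc0 n]
  have hcauchy : CauchySeq x := by
    refine cauchySeq_of_le_geometric (1 / 2) 1 (by norm_num) fun n => ?_
    rw [dist_comm, dist_eq_norm, one_mul]
    exact (hdist n).le
  obtain ⟨y₀, hy₀⟩ := cauchySeq_tendsto_of_complete hcauchy
  have hy₀D : y₀ ∈ D := hD.mem_of_tendsto hy₀ (Eventually.of_forall hxD)
  have hcsum : HasSum c (κ / (2 * (K + 1)) * (8 / 7)) := by
    have := (hasSum_geometric_of_lt_one (r := (1 / 8 : ℝ)) (by norm_num) (by norm_num)).mul_left
      (κ / (2 * (K + 1)))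
    rwa [show (1 - 1 / 8 : ℝ)⁻¹ = 8 / 7 by norm_num] at this
  have hd : HasSum (fun n => c n * (K / r n)) (κ / (2 * (K + 1)) * K * (4 / 3)) := by
    have := (hasSum_geometric_of_lt_one (r := (1 / 4 : ℝ)) (by norm_num) (by norm_num)).mul_left
      (κ / (2 * (K + 1)) * K)
    rw [show (1 - 1 / 4 : ℝ)⁻¹ = 4 / 3 by norm_num] at this
    refine this.congr_fun fun n => ?_
    simp only [hc, hr]
    have : (1 / 8 : ℝ) ^ n = (1 / 4) ^ n * (1 / 2) ^ n := by rw [← mul_pow]; norm_num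
    rw [this]
    field_simp
  have hts : ∀ y, Summable fun n => t n y := fun y =>
    Summable.of_nonneg_of_le (fun n => ht0 n y) (fun n => ht1 n y) hcsum.summable
  have ht' : ∀ n y, HasFDerivAt (t n) (c n • β' (r n) (x n) y) y := fun n y =>
    (hβ.hasFDerivAt _ (hr0 n) _ y).const_mul _
  have ht'b : ∀ n y, ‖c n • β' (r n) (x n) y‖ ≤ c n * (K / r n) := fun n y => by
    rw [norm_smul, Real.norm_of_nonneg (hc0 n).le]
    exact mul_le_mul_of_nonneg_left (hβ.norm_le _ (hr0 n) _ _) (hc0 n).le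
  have hp' := fun y => hasFDerivAt_tsum hd.summable ht' ht'b (hts y₀) y
  have hPsum : ∀ n y, P n y = ∑ k ∈ Finset.range n, t k y := by
    intro n y
    induction n with
    | zero => rfl
    | succ n ih => rw [hPs, Finset.sum_range_succ, ih]
  have hPlim : ∀ y, Tendsto (fun n => P n y) atTop (𝓝 (∑' k, t k y)) := fun y => by
    simpa only [hPsum] using (hts y).hasSum.tendsto_sum_nat
  have hPle : ∀ n y, P n y ≤ ∑' k, t k y := fun n y => (hPmono y).ge_of_tendsto (hPlim y) n
  refine ⟨fun y => ∑' k, t k y, _, hp', fun y => ?_, fun y => tsum_nonneg fun n => ht0 n y,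
    fun y => ?_, y₀, hy₀D, fun z hz => ?_⟩
  · refine (tsum_of_norm_bounded hd fun n => ht'b n y).trans ?_
    rw [div_mul_eq_mul_div, div_mul_eq_mul_div, div_le_iff₀ (by positivity)]
    nlinarith [mul_nonneg hκ.le hK]
  · refine ((hts y).tsum_le_tsum (fun n => ht1 n y) hcsum.summable).trans ?_
    rw [hcsum.tsum_eq, div_mul_eq_mul_div, div_le_iff₀ (by positivity)]
    nlinarith [mul_nonneg hκ.le hK]
  · refine le_of_forall_pos_le_add fun ε hε => ?_
    have hgx : ∀ᶠ n in atTop, g (x n) < g y₀ + ε :=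
      (tendsto_nhdsWithin_iff.2 ⟨hy₀, Eventually.of_forall hxD⟩).eventually
        (hg y₀ hy₀D _ (lt_add_of_pos_right _ hε))
    have hc00 : Tendsto (fun n => c n / 2) atTop (𝓝 0) := by
      simpa using hcsum.summable.tendsto_atTop_zero.div_const 2
    have hpx : Tendsto (fun n => g y₀ + ε + ∑' k, t k (x n) + c n / 2) atTop
        (𝓝 (g y₀ + ε + ∑' k, t k y₀ + 0)) :=
      (((hp' y₀).continuousAt.tendsto.comp hy₀).const_add _).add hc00
    have := le_of_tendsto_of_tendsto ((hPlim z).const_add (g z)) hpx <| by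
      filter_upwards [hgx] with n hn
      linarith [hxmax n z hz, hPle n (x n)]
    linarith

theorem neg_mem_superdiffOn {Ω : Set X} {w q : X → ℝ} {q' : X →L[ℝ] ℝ} {y : X}
    (hq : HasFDerivAt q q' y) (hmax : ∀ᶠ z in 𝓝 y, w z + q z ≤ w y + q y) :
    -q' ∈ superdiffOn Ω w y := by
  intro ε hε
  obtain ⟨δ, hδ, h⟩ := Metric.eventually_nhds_iff.1 (hmax.and (hq.isLittleO.def hε))
  refine ⟨δ, hδ, fun v hv _ => ?_⟩
  obtain ⟨h1, h2⟩ := h (y := y + v) (by simpa [dist_eq_norm] using hv)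
  rw [add_sub_cancel_left, Real.norm_eq_abs] at h2
  have := (abs_le.1 h2).1
  rw [neg_apply]
  linarith

theorem eq_of_mem_superdiffOn {Ω : Set X} (hΩ : IsOpen Ω) {w φ : X → ℝ} {φ' Δ : X →L[ℝ] ℝ} {y : X}
    (hy : y ∈ Ω) (hΔ : Δ ∈ superdiffOn Ω w y) (hφ : HasFDerivAt φ φ' y)
    (hle : ∀ᶠ z in 𝓝 y, φ z ≤ w z) (heq : w y = φ y) : Δ = φ' := by
  have key : ∀ ε > 0, ∀ᶠ z in 𝓝 y, (φ' - Δ) (z - y) ≤ 2 * ε * ‖z - y‖ := by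
    intro ε hε
    obtain ⟨δ, hδ, h⟩ := hΔ ε hε
    filter_upwards [hle, hφ.isLittleO.def hε, hΩ.mem_nhds hy, Metric.ball_mem_nhds y hδ]
      with z h1 h2 h3 h4
    have h5 := h (z - y) (by simpa [dist_eq_norm] using h4) (by simpa using h3)
    rw [Real.norm_eq_abs] at h2
    have := (abs_le.1 h2).1
    rw [add_sub_cancel] at h5
    rw [sub_apply]
    linarith
  have key2 : ∀ v, (φ' - Δ) v ≤ 0 := by
    intro v
    refine le_of_forall_pos_le_add fun ε hε => ?_
    have ht : Tendsto (fun s : ℝ => y + s • v) (𝓝[>] 0) (𝓝 y) := by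
      have : Continuous fun s : ℝ => y + s • v := by fun_prop
      simpa using (this.tendsto 0).mono_left nhdsWithin_le_nhds
    obtain ⟨s, hs, hs0⟩ := ((ht.eventually (key (ε / (2 * (‖v‖ + 1))) (by positivity))).and
      self_mem_nhdsWithin).exists
    have hs0 : 0 < s := hs0
    rw [add_sub_cancel_left, map_smul, smul_eq_mul, norm_smul, Real.norm_of_nonneg hs0.le,
      mul_left_comm] at hs
    have h1 := le_of_mul_le_mul_left hs hs0
    have h2 : 2 * (ε / (2 * (‖v‖ + 1))) * ‖v‖ ≤ ε := by
      rw [show 2 * (ε / (2 * (‖v‖ + 1))) * ‖v‖ = ε * ‖v‖ / (‖v‖ + 1) by field_simp,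
        div_le_iff₀ (by positivity)]
      linarith
    linarith
  ext v
  have h1 := key2 v
  have h2 := key2 (-v)
  simp only [map_neg, sub_apply] at h1 h2
  linarith

theorem ContinuousOn.isBoundedUnder_le_of_le {Y : Type*} [TopologicalSpace Y] {Ω : Set Y}
    {s f : Y → ℝ} (hs : ContinuousOn s Ω)
    (hf : ∀ y ∈ Ω, f y ≤ s y) {x : Y} (hx : x ∈ Ω) :
    IsBoundedUnder (· ≤ ·) (𝓝[Ω] x) f :=
  (hs x hx).isBoundedUnder_le.mono_le (eventually_nhdsWithin_of_forall hf)

theorem ContinuousOn.isBoundedUnder_ge_of_le {Y : Type*} [TopologicalSpace Y] {Ω : Set Y}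
    {s f : Y → ℝ} (hs : ContinuousOn s Ω)
    (hf : ∀ y ∈ Ω, s y ≤ f y) {x : Y} (hx : x ∈ Ω) :
    IsBoundedUnder (· ≥ ·) (𝓝[Ω] x) f :=
  (hs x hx).isBoundedUnder_ge.mono_ge (eventually_nhdsWithin_of_forall hf)

section Envelopes

variable {E : Type*} [NormedAddCommGroup E] {Ω : Set E} {s₀ s₁ f : E → ℝ}

theorem uscEnv_le_of_eventually_le (hs₀ : ContinuousOn s₀ Ω) (h₀ : ∀ y ∈ Ω, s₀ y ≤ f y) {x : E}
    (hx : x ∈ Ω) {c : ℝ} (h : ∀ᶠ y in 𝓝[Ω] x, f y ≤ c) : uscEnv Ω f x ≤ c := by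
  have : (𝓝[Ω] x).NeBot := mem_closure_iff_nhdsWithin_neBot.1 (subset_closure hx)
  exact limsup_le_of_le (hs₀.isBoundedUnder_ge_of_le h₀ hx).isCoboundedUnder_le h

theorem le_lscEnv_of_eventually_le (hs₁ : ContinuousOn s₁ Ω) (h₁ : ∀ y ∈ Ω, f y ≤ s₁ y) {x : E}
    (hx : x ∈ Ω) {c : ℝ} (h : ∀ᶠ y in 𝓝[Ω] x, c ≤ f y) : c ≤ lscEnv Ω f x := by
  have : (𝓝[Ω] x).NeBot := mem_closure_iff_nhdsWithin_neBot.1 (subset_closure hx)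
  exact le_liminf_of_le (hs₁.isBoundedUnder_le_of_le h₁ hx).isCoboundedUnder_ge h

theorem frequently_lt_of_lt_uscEnv (hs₀ : ContinuousOn s₀ Ω) (h₀ : ∀ y ∈ Ω, s₀ y ≤ f y) {x : E}
    (hx : x ∈ Ω) {c : ℝ} (h : c < uscEnv Ω f x) : ∃ᶠ y in 𝓝[Ω] x, c < f y := by
  have : (𝓝[Ω] x).NeBot := mem_closure_iff_nhdsWithin_neBot.1 (subset_closure hx)
  exact frequently_lt_of_lt_limsup (hs₀.isBoundedUnder_ge_of_le h₀ hx).isCoboundedUnder_le h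

theorem eventually_lt_of_uscEnv_lt (hs₁ : ContinuousOn s₁ Ω) (h₁ : ∀ y ∈ Ω, f y ≤ s₁ y) {x : E}
    (hx : x ∈ Ω) {c : ℝ} (h : uscEnv Ω f x < c) : ∀ᶠ y in 𝓝[Ω] x, f y < c :=
  eventually_lt_of_limsup_lt h (hs₁.isBoundedUnder_le_of_le h₁ hx)

theorem eventually_lt_of_lt_lscEnv (hs₀ : ContinuousOn s₀ Ω) (h₀ : ∀ y ∈ Ω, s₀ y ≤ f y) {x : E}
    (hx : x ∈ Ω) {c : ℝ} (h : c < lscEnv Ω f x) : ∀ᶠ y in 𝓝[Ω] x, c < f y :=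
  eventually_lt_of_lt_liminf h (hs₀.isBoundedUnder_ge_of_le h₀ hx)

theorem le_uscEnv_s15 (hs₁ : ContinuousOn s₁ Ω) (h₁ : ∀ y ∈ Ω, f y ≤ s₁ y) {x : E}
    (hx : x ∈ Ω) : f x ≤ uscEnv Ω f x := by
  by_contra! h
  exact lt_irrefl _ ((eventually_lt_of_uscEnv_lt hs₁ h₁ hx h).self_of_nhdsWithin hx)

theorem lscEnv_le (hs₀ : ContinuousOn s₀ Ω) (h₀ : ∀ y ∈ Ω, s₀ y ≤ f y) {x : E}
    (hx : x ∈ Ω) : lscEnv Ω f x ≤ f x := by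
  by_contra! h
  exact lt_irrefl _ ((eventually_lt_of_lt_lscEnv hs₀ h₀ hx h).self_of_nhdsWithin hx)

theorem uscEnv_le_of_le (hs₀ : ContinuousOn s₀ Ω) (h₀ : ∀ y ∈ Ω, s₀ y ≤ f y)
    (hs₁ : ContinuousOn s₁ Ω) (h₁ : ∀ y ∈ Ω, f y ≤ s₁ y) {x : E} (hx : x ∈ Ω) :
    uscEnv Ω f x ≤ s₁ x := by
  refine le_of_forall_gt_imp_ge_of_dense fun c hc => uscEnv_le_of_eventually_le hs₀ h₀ hx ?_
  filter_upwards [(hs₁ x hx).eventually_lt_const hc, self_mem_nhdsWithin] with y hy hyΩ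
  exact (h₁ y hyΩ).trans hy.le

theorem le_lscEnv_of_le (hs₀ : ContinuousOn s₀ Ω) (h₀ : ∀ y ∈ Ω, s₀ y ≤ f y)
    (hs₁ : ContinuousOn s₁ Ω) (h₁ : ∀ y ∈ Ω, f y ≤ s₁ y) {x : E} (hx : x ∈ Ω) :
    s₀ x ≤ lscEnv Ω f x := by
  refine le_of_forall_lt_imp_le_of_dense fun c hc => le_lscEnv_of_eventually_le hs₁ h₁ hx ?_
  filter_upwards [(hs₀ x hx).eventually_const_lt hc, self_mem_nhdsWithin] with y hy hyΩ
  exact hy.le.trans (h₀ y hyΩ)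

theorem upperSemicontinuousOn_uscEnv (hs₀ : ContinuousOn s₀ Ω) (h₀ : ∀ y ∈ Ω, s₀ y ≤ f y)
    (hs₁ : ContinuousOn s₁ Ω) (h₁ : ∀ y ∈ Ω, f y ≤ s₁ y) :
    UpperSemicontinuousOn (uscEnv Ω f) Ω := by
  intro x hx c hc
  obtain ⟨d, hd, hdc⟩ := exists_between hc
  filter_upwards [eventually_eventually_nhdsWithin.2 (eventually_lt_of_uscEnv_lt hs₁ h₁ hx hd),
    self_mem_nhdsWithin] with y hy hyΩ
  exact (uscEnv_le_of_eventually_le hs₀ h₀ hyΩ (hy.mono fun _ => le_of_lt)).trans_lt hdc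

theorem lowerSemicontinuousOn_lscEnv (hs₀ : ContinuousOn s₀ Ω) (h₀ : ∀ y ∈ Ω, s₀ y ≤ f y)
    (hs₁ : ContinuousOn s₁ Ω) (h₁ : ∀ y ∈ Ω, f y ≤ s₁ y) :
    LowerSemicontinuousOn (lscEnv Ω f) Ω := by
  intro x hx c hc
  obtain ⟨d, hcd, hd⟩ := exists_between hc
  filter_upwards [eventually_eventually_nhdsWithin.2 (eventually_lt_of_lt_lscEnv hs₀ h₀ hx hd),
    self_mem_nhdsWithin] with y hy hyΩ
  exact hcd.trans_le (le_lscEnv_of_eventually_le hs₁ h₁ hyΩ (hy.mono fun _ => le_of_lt))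

end Envelopes

theorem exists_radius_pos {Ω : Set X} {F : X → (X →L[ℝ] ℝ) → ℝ → ℝ}
    (hF : ContinuousOn (fun p : X × (X →L[ℝ] ℝ) × ℝ => F p.1 p.2.1 p.2.2)
      {p : X × (X →L[ℝ] ℝ) × ℝ | p.1 ∈ Ω})
    {x : X} (hx : x ∈ Ω) {Δ : X →L[ℝ] ℝ} {s : ℝ} (hpos : 0 < F x Δ s) :
    ∃ ρ > 0, ∀ y ∈ Ω, ∀ Γ t, ‖y - x‖ < ρ → ‖Γ - Δ‖ < ρ → |t - s| < ρ → 0 < F y Γ t := by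
  have h := (hF (x, Δ, s) hx).eventually_const_lt hpos
  obtain ⟨ρ, hρ, h⟩ := Metric.mem_nhdsWithin_iff.1 h
  refine ⟨ρ, hρ, fun y hy Γ t h1 h2 h3 =>
    h (show (y, Γ, t) ∈ _ from ⟨?_, show (y, Γ, t).1 ∈ Ω from hy⟩)⟩
  rw [← dist_eq_norm] at h1 h2
  exact max_lt h1 (max_lt h2 h3)

/-- There are arbitrarily small radii subject to finitely many typical constraints. -/
theorem exists_small_radius {E : Type*} [SeminormedAddCommGroup E] {Ω : Set E} (hΩ : IsOpen Ω)
    {x : E} (hx : x ∈ Ω) {δ ρ A : ℝ}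
    (hδ : 0 < δ) (hρ : 0 < ρ) (hA : 0 ≤ A) :
    ∃ r > 0, 2 * r < δ ∧ 2 * r < ρ ∧ A * r < ρ ∧ ∀ y, ‖y - x‖ ≤ 2 * r → y ∈ Ω := by
  obtain ⟨d, hd, hball⟩ := Metric.isOpen_iff.1 hΩ x hx
  have hm : 0 < min (min δ d) (ρ / (A + 1)) := by positivity
  have hA' : ρ / (A + 1) * (A + 1) = ρ := div_mul_cancel₀ _ (by positivity)
  have h1 := min_le_left (min δ d) (ρ / (A + 1))
  have h2 := min_le_right (min δ d) (ρ / (A + 1))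
  have h3 := min_le_left δ d
  have h4 := min_le_right δ d
  set m := min (min δ d) (ρ / (A + 1))
  have h5 : m * (A + 1) ≤ ρ := by
    rw [← hA']; gcongr
  have h6 := mul_nonneg hm.le hA
  refine ⟨m / 4, by positivity, by linarith, by linarith, by linarith, fun y hy => hball ?_⟩
  rw [mem_ball_iff_norm]
  linarith

/-- The upper semicontinuous envelope of a supremum of subsolutions is a subsolution. -/
theorem isSubsolOn_uscEnv [CompleteSpace X] (hbump : HasC1LipBump X)
    {Ω : Set X} (hΩ : IsOpen Ω) {F : X → (X →L[ℝ] ℝ) → ℝ → ℝ}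
    (hF : ContinuousOn (fun p : X × (X →L[ℝ] ℝ) × ℝ => F p.1 p.2.1 p.2.2)
      {p : X × (X →L[ℝ] ℝ) × ℝ | p.1 ∈ Ω})
    {s₀ s₁ u : X → ℝ} (hs₀ : ContinuousOn s₀ Ω) (hs₁ : ContinuousOn s₁ Ω)
    (h₀ : ∀ y ∈ Ω, s₀ y ≤ u y) (h₁ : ∀ y ∈ Ω, u y ≤ s₁ y)
    (happrox : ∀ x ∈ Ω, ∀ c < u x, ∃ w, IsSubsolOn Ω F w ∧ (∀ y ∈ Ω, w y ≤ u y) ∧ c < w x) :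
    IsSubsolOn Ω F (uscEnv Ω u) := by
  obtain ⟨K, hK, β, β', hβ⟩ := hbump.exists_isBumpFamily
  refine ⟨upperSemicontinuousOn_uscEnv hs₀ h₀ hs₁ h₁, fun x hx Δ hΔ => ?_⟩
  by_contra! hpos
  obtain ⟨ρ, hρ, hFpos⟩ := exists_radius_pos hF hx hpos
  set a := uscEnv Ω u x
  set ε := ρ / (4 * K + 2)
  have hε : 0 < ε := by positivity
  have hερ : 4 * ε * K + ε < ρ := by
    have : ε * (4 * K + 2) = ρ := div_mul_cancel₀ _ (by positivity)
    linarith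
  obtain ⟨δ, hδ, hsup⟩ := hΔ ε hε
  obtain ⟨r, hr, hrδ, hrρ, hrA, hrΩ⟩ := exists_small_radius hΩ hx hδ hρ
    (A := ‖Δ‖ + 2 * ε) (by positivity)
  have hεr : 0 < ε * r := by positivity
  have hup : ∀ y, ‖y - x‖ ≤ 2 * r → uscEnv Ω u y ≤ a + Δ (y - x) + ε * ‖y - x‖ := by
    intro y hy
    have := hsup (y - x) (by linarith) (by simpa using hrΩ y hy)
    rwa [add_sub_cancel] at this
  set q : X → ℝ := fun y => 4 * ε * r * β r x y - Δ (y - x) with hq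
  have hqd : ∀ y, HasFDerivAt q ((4 * ε * r) • β' r x y - Δ) y := by
    intro y
    refine ((hβ.hasFDerivAt r hr x y).const_mul _).sub ?_
    exact Δ.hasFDerivAt.comp y ((hasFDerivAt_id y).sub_const x)
  have hqx : q x = 4 * ε * r := by simp [hq, hβ.center]
  have hnhds : ∀ᶠ z in 𝓝[Ω] x, 4 * ε * r - ε * r / 2 < q z ∧ z ∈ Metric.ball x r ∧ z ∈ Ω := by
    filter_upwards [nhdsWithin_le_nhds ((hqd x).continuousAt.eventually_const_lt
        (show 4 * ε * r - ε * r / 2 < q x by rw [hqx]; linarith)),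
      nhdsWithin_le_nhds (Metric.ball_mem_nhds x hr), self_mem_nhdsWithin] with z h1 h2 h3
    exact ⟨h1, h2, h3⟩
  obtain ⟨z, hzu, hzq, hzr, hzΩ⟩ := ((frequently_lt_of_lt_uscEnv hs₀ h₀ hx
    (show a - ε * r / 2 < a by linarith)).and_eventually hnhds).exists
  have hzr : ‖z - x‖ < r := mem_ball_iff_norm.1 hzr
  obtain ⟨w, hw, hwu, hwz⟩ := happrox z hzΩ _ hzu
  have hwus : ∀ y ∈ Ω, w y ≤ uscEnv Ω u y := fun y hy =>
    (hwu y hy).trans (le_uscEnv_s15 hs₁ h₁ hy)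
  have hDΩ : Metric.closedBall x (2 * r) ⊆ Ω := fun y hy => hrΩ y (mem_closedBall_iff_norm.1 hy)
  have hΔle : ∀ y, |Δ (y - x)| ≤ ‖Δ‖ * ‖y - x‖ := fun y => Δ.le_opNorm (y - x)
  obtain ⟨p, p', hp, hp'le, hp0, hple, y, hyD, hymax⟩ :=
    hβ.exists_perturbed_max hK (D := Metric.closedBall x (2 * r)) (g := fun y => w y + q y)
      Metric.isClosed_closedBall ⟨x, by simp [hr.le]⟩
      ((hw.1.mono hDΩ).add (fun y _ =>
        (hqd y).continuousAt.upperSemicontinuousAt.upperSemicontinuousWithinAt _))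
      (M := a + ε * (2 * r) + 4 * ε * r)
      (fun y hy => by
        have h1 := hwus y (hDΩ hy)
        rw [mem_closedBall_iff_norm] at hy
        have h2 := hup y hy
        have h3 : ε * ‖y - x‖ ≤ ε * (2 * r) := by gcongr
        have h4 : 4 * ε * r * β r x y ≤ 4 * ε * r :=
          mul_le_of_le_one_right (by positivity) (hβ.le_one _ _ _)
        simp only [hq]
        linarith)
      (κ := min ε (ε * r / 2)) (by positivity)
  have hyΩ := hDΩ hyD
  have hyD' := mem_closedBall_iff_norm.1 hyD
  have h1 := hymax z (mem_closedBall_iff_norm.2 (by linarith))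
  have h2 := hup y hyD'
  have h3 := hwus y hyΩ
  have h4 := hp0 z
  have h5 := (hple y).trans (min_le_right _ _)
  have hyr : ‖y - x‖ < r := by
    by_contra! hcon
    have h6 : q y = - Δ (y - x) := by simp [hq, hβ.eq_zero r hr x y hcon]
    have h7 : ε * ‖y - x‖ ≤ ε * (2 * r) := by gcongr
    linarith
  have h6 := abs_le.1 (hΔle y)
  have h7 : ‖Δ‖ * ‖y - x‖ ≤ ‖Δ‖ * r := by gcongr
  have h8 : ε * ‖y - x‖ ≤ ε * r := by gcongr
  have h9 : 4 * ε * r * β r x y ≤ 4 * ε * r :=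
    mul_le_of_le_one_right (by positivity) (hβ.le_one _ _ _)
  have hqy : q y = 4 * ε * r * β r x y - Δ (y - x) := rfl
  have hmem : -(((4 * ε * r) • β' r x y - Δ) + p' y) ∈ superdiffOn Ω w y := by
    refine neg_mem_superdiffOn ((hqd y).add (hp y)) ?_
    have : ∀ᶠ z in 𝓝 y, z ∈ Metric.ball x r :=
      Metric.isOpen_ball.mem_nhds (mem_ball_iff_norm.2 hyr)
    filter_upwards [this] with z hz
    have := hymax z (Metric.ball_subset_closedBall (Metric.ball_subset_ball (by linarith) hz))
    simp only [Pi.add_apply]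
    linarith
  refine (hw.2 y hyΩ _ hmem).not_gt (hFpos y hyΩ _ _ (by linarith) ?_ ?_)
  · have e : -(((4 * ε * r) • β' r x y - Δ) + p' y) - Δ = -((4 * ε * r) • β' r x y + p' y) := by
      abel
    rw [e, norm_neg]
    refine (norm_add_le _ _).trans_lt ?_
    rw [norm_smul, Real.norm_of_nonneg (by positivity)]
    have h10 : 4 * ε * r * ‖β' r x y‖ ≤ 4 * ε * r * (K / r) := by
      gcongr; exact hβ.norm_le r hr x y
    have h11 : 4 * ε * r * (K / r) = 4 * ε * K := by field_simp
    have h12 := (hp'le y).trans (min_le_left _ _)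
    linarith
  · rw [abs_lt]
    constructor <;> linarith

/-- Perron's bump construction: if every admissible subsolution above `U` is at most `U`, then the
lower semicontinuous envelope of the subsolution `U` is a supersolution. -/
theorem isSupersolOn_lscEnv (hbump : HasC1LipBump X)
    {Ω : Set X} (hΩ : IsOpen Ω) {F : X → (X →L[ℝ] ℝ) → ℝ → ℝ}
    (hF : ContinuousOn (fun p : X × (X →L[ℝ] ℝ) × ℝ => F p.1 p.2.1 p.2.2)
      {p : X × (X →L[ℝ] ℝ) × ℝ | p.1 ∈ Ω})
    {s₀ s₁ U : X → ℝ} (hs₀ : ContinuousOn s₀ Ω) (hs₁ : ContinuousOn s₁ Ω)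
    (hsup : IsSupersolOn Ω F s₁)
    (h₀ : ∀ y ∈ Ω, s₀ y ≤ U y) (h₁ : ∀ y ∈ Ω, U y ≤ s₁ y) (hU : IsSubsolOn Ω F U)
    (hmax : ∀ w, IsSubsolOn Ω F w → (∀ y ∈ Ω, U y ≤ w y) → (∀ y ∈ Ω, w y ≤ s₁ y) →
      ∀ y ∈ Ω, w y ≤ U y) :
    IsSupersolOn Ω F (lscEnv Ω U) := by
  obtain ⟨K, hK, β, β', hβ⟩ := hbump.exists_isBumpFamily
  refine ⟨lowerSemicontinuousOn_lscEnv hs₀ h₀ hs₁ h₁, fun x hx Δ hΔ => ?_⟩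
  by_contra! hneg
  have hvU : ∀ y ∈ Ω, lscEnv Ω U y ≤ U y := fun y hy => lscEnv_le hs₀ h₀ hy
  set a := lscEnv Ω U x
  have has₁ : a < s₁ x := by
    refine lt_of_le_of_ne ((hvU x hx).trans (h₁ x hx)) fun h => hneg.not_ge ?_
    rw [h]
    refine hsup.2 x hx Δ fun ε hε => ?_
    obtain ⟨δ, hδ, hd⟩ := hΔ ε hε
    refine ⟨δ, hδ, fun k hk hkΩ => ?_⟩
    rw [← h]
    exact (hd k hk hkΩ).trans ((hvU _ hkΩ).trans (h₁ _ hkΩ))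
  obtain ⟨ρ₁, hρ₁, hFneg⟩ := exists_radius_pos (F := fun y Γ t => -F y Γ t) hF.neg hx
    (neg_pos.2 hneg)
  obtain ⟨b, hab, hb⟩ := exists_between has₁
  obtain ⟨ρ₂, hρ₂, hsb⟩ := Metric.mem_nhdsWithin_iff.1 ((hs₁ x hx).eventually_const_lt hb)
  set ρ := min ρ₁ (min ρ₂ (b - a))
  have hρ : 0 < ρ := by have := sub_pos.2 hab; positivity
  have hρρ₁ : ρ ≤ ρ₁ := min_le_left _ _
  have hρρ₂ : ρ ≤ ρ₂ := (min_le_right _ _).trans (min_le_left _ _)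
  have hρb : ρ ≤ b - a := (min_le_right _ _).trans (min_le_right _ _)
  set ε := ρ / (4 * K + 2)
  have hε : 0 < ε := by positivity
  have hερ : 4 * ε * K < ρ := by
    have : ε * (4 * K + 2) = ρ := div_mul_cancel₀ _ (by positivity)
    linarith
  obtain ⟨δ, hδ, hsub⟩ := hΔ ε hε
  obtain ⟨r, hr, hrδ, hrρ, hrA, hrΩ⟩ := exists_small_radius hΩ hx hδ hρ
    (A := 2 * ‖Δ‖ + 3 * ε) (by positivity)
  have hεr : 0 < ε * r := by positivity
  set φ : X → ℝ := fun y => a - 3 * ε * r + (4 * ε * r * β r x y + Δ (y - x)) with hφ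
  have hφd : ∀ y, HasFDerivAt φ ((4 * ε * r) • β' r x y + Δ) y := by
    intro y
    refine (((hβ.hasFDerivAt r hr x y).const_mul _).add ?_).const_add _
    exact Δ.hasFDerivAt.comp y ((hasFDerivAt_id y).sub_const x)
  have hφx : φ x = a + ε * r := by
    simp only [hφ, hβ.center, sub_self, map_zero]; ring
  have hφring : ∀ y, r ≤ ‖y - x‖ → ‖y - x‖ < 2 * r → φ y ≤ U y := by
    intro y h1 h2
    have h3 := hsub (y - x) (by linarith) (by simpa using hrΩ y h2.le)
    rw [add_sub_cancel] at h3
    have h4 := hvU y (hrΩ y h2.le)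
    have h5 : ε * ‖y - x‖ ≤ ε * (2 * r) := by gcongr
    simp only [hφ, hβ.eq_zero r hr x y h1]
    linarith
  have hφabs : ∀ y, ‖y - x‖ < 2 * r → |φ y - a| < ρ := by
    intro y h1
    have h2 := abs_le.1 (Δ.le_opNorm (y - x))
    have h3 : ‖Δ‖ * ‖y - x‖ ≤ ‖Δ‖ * (2 * r) := by gcongr
    have h4 : 4 * ε * r * β r x y ≤ 4 * ε * r :=
      mul_le_of_le_one_right (by positivity) (hβ.le_one _ _ _)
    have h5 : 0 ≤ 4 * ε * r * β r x y := mul_nonneg (by positivity) (hβ.nonneg _ _ _)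
    simp only [hφ]
    rw [abs_lt]
    constructor <;> linarith
  classical
  set w : X → ℝ := fun y => if ‖y - x‖ < 2 * r then max (U y) (φ y) else U y with hw
  have hwin : ∀ y, ‖y - x‖ < 2 * r → w y = max (U y) (φ y) := fun y hy => if_pos hy
  have hwout : ∀ y, r < ‖y - x‖ → w y = U y := by
    intro y hy
    by_cases h : ‖y - x‖ < 2 * r
    · rw [hwin y h, max_eq_left (hφring y hy.le h)]
    · exact if_neg h
  have hUw : ∀ y, U y ≤ w y := by
    intro y
    simp only [hw]
    split_ifs
    exacts [le_max_left _ _, le_rfl]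
  have hcont : Continuous fun y : X => ‖y - x‖ := by fun_prop
  have hws₁ : ∀ y ∈ Ω, w y ≤ s₁ y := by
    intro y hy
    by_cases h : ‖y - x‖ < 2 * r
    · rw [hwin y h]
      have h1 : b < s₁ y := hsb ⟨mem_ball_iff_norm.2 (by linarith), hy⟩
      have h2 := (abs_lt.1 (hφabs y h)).2
      exact max_le (h₁ y hy) (by linarith)
    · rw [hwout y (by linarith)]
      exact h₁ y hy
  have hwsub : IsSubsolOn Ω F w := by
    refine ⟨fun y hy c hc => ?_, fun y hy Γ hΓ => ?_⟩
    · change w y < c at hc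
      by_cases h : ‖y - x‖ < 2 * r
      · rw [hwin y h, max_lt_iff] at hc
        filter_upwards [hU.1 y hy c hc.1,
          nhdsWithin_le_nhds ((hφd y).continuousAt.eventually_lt_const hc.2),
          nhdsWithin_le_nhds (hcont.continuousAt.eventually_lt_const h)] with z h1 h2 h3
        exact (hwin z h3).trans_lt (max_lt h1 h2)
      · have hlt : r < ‖y - x‖ := by linarith
        rw [hwout y hlt] at hc
        filter_upwards [hU.1 y hy c hc,
          nhdsWithin_le_nhds (hcont.continuousAt.eventually_const_lt hlt)] with z h1 h2
        exact (hwout z h2).trans_lt h1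
    · by_cases heq : w y = U y
      · rw [heq]
        refine hU.2 y hy Γ fun ε' hε' => ?_
        obtain ⟨δ', hδ', hd⟩ := hΓ ε' hε'
        refine ⟨δ', hδ', fun k hk hkΩ => ?_⟩
        rw [← heq]
        exact (hUw _).trans (hd k hk hkΩ)
      · have h : ‖y - x‖ < 2 * r := by
          by_contra hcon
          exact heq (if_neg hcon)
        have hwφ : w y = φ y := by
          rw [hwin y h] at heq ⊢
          exact (max_choice _ _).resolve_left heq
        have hΓeq := eq_of_mem_superdiffOn hΩ hy hΓ (hφd y) (by
          filter_upwards [hcont.continuousAt.eventually_lt_const h] with z hz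
          rw [hwin z hz]
          exact le_max_right _ _) hwφ
        have hnorm : ‖Γ - Δ‖ < ρ := by
          rw [hΓeq, add_sub_cancel_right, norm_smul, Real.norm_of_nonneg (by positivity)]
          have h10 : 4 * ε * r * ‖β' r x y‖ ≤ 4 * ε * r * (K / r) := by
            gcongr; exact hβ.norm_le r hr x y
          have h11 : 4 * ε * r * (K / r) = 4 * ε * K := by field_simp
          linarith
        have := hFneg y hy Γ (w y) (by linarith) (by linarith)
          (by rw [hwφ]; exact (hφabs y h).trans_le hρρ₁)
        linarith
  have hwU := hmax w hwsub (fun y _ => hUw y) hws₁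
  have : a + ε * r / 2 ≤ a := by
    refine le_lscEnv_of_eventually_le hs₁ h₁ hx ?_
    filter_upwards [nhdsWithin_le_nhds ((hφd x).continuousAt.eventually_const_lt
        (show a + ε * r / 2 < φ x by rw [hφx]; linarith)),
      nhdsWithin_le_nhds (Metric.ball_mem_nhds x hr), self_mem_nhdsWithin] with y h1 h2 h3
    rw [mem_ball_iff_norm] at h2
    refine h1.le.trans (le_trans ?_ (hwU y h3))
    rw [hwin y (by linarith)]
    exact le_max_right _ _
  linarith

theorem stmt15 [CompleteSpace X] (hbump : HasC1LipBump X)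
    (Ω : Set X) (hΩopen : IsOpen Ω)
    (F : X → (X →L[ℝ] ℝ) → ℝ → ℝ)
    (hFcont : ContinuousOn (fun p : X × (X →L[ℝ] ℝ) × ℝ => F p.1 p.2.1 p.2.2)
      {p : X × (X →L[ℝ] ℝ) × ℝ | p.1 ∈ Ω})
    (s₀ s₁ : X → ℝ) (hs₀cont : ContinuousOn s₀ Ω) (hs₁cont : ContinuousOn s₁ Ω)
    (hle : ∀ x ∈ Ω, s₀ x ≤ s₁ x)
    (hs₀ : IsSubsolOn Ω F s₀) (hs₁ : IsSupersolOn Ω F s₁)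
    (u : X → ℝ)
    (hu : ∀ x ∈ Ω, IsLUB {r : ℝ | ∃ w : X → ℝ,
      (∀ y ∈ Ω, s₀ y ≤ w y ∧ w y ≤ s₁ y) ∧ IsSubsolOn Ω F w ∧ r = w x} (u x)) :
    IsSubsolOn Ω F (uscEnv Ω u) ∧
    IsSupersolOn Ω F (lscEnv Ω (uscEnv Ω u)) ∧
    ∀ x ∈ Ω, s₀ x ≤ lscEnv Ω (uscEnv Ω u) x ∧
      lscEnv Ω (uscEnv Ω u) x ≤ uscEnv Ω u x ∧ uscEnv Ω u x ≤ s₁ x := by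
  have h₀ : ∀ y ∈ Ω, s₀ y ≤ u y := fun y hy =>
    (hu y hy).1 ⟨s₀, fun z hz => ⟨le_rfl, hle z hz⟩, hs₀, rfl⟩
  have h₁ : ∀ y ∈ Ω, u y ≤ s₁ y := fun y hy => (hu y hy).2 <| by
    rintro _ ⟨w, hw, _, rfl⟩
    exact (hw y hy).2
  have hle_env : ∀ y ∈ Ω, u y ≤ uscEnv Ω u y := fun y hy => le_uscEnv_s15 hs₁cont h₁ hy
  have h₀' : ∀ y ∈ Ω, s₀ y ≤ uscEnv Ω u y := fun y hy => (h₀ y hy).trans (hle_env y hy)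
  have h₁' : ∀ y ∈ Ω, uscEnv Ω u y ≤ s₁ y := fun y hy =>
    uscEnv_le_of_le hs₀cont h₀ hs₁cont h₁ hy
  have hsub : IsSubsolOn Ω F (uscEnv Ω u) := by
    refine isSubsolOn_uscEnv hbump hΩopen hFcont hs₀cont hs₁cont h₀ h₁ fun x hx c hc => ?_
    obtain ⟨_, ⟨w, hw, hwsub, rfl⟩, hcw⟩ := (lt_isLUB_iff (hu x hx)).1 hc
    exact ⟨w, hwsub, fun y hy => (hu y hy).1 ⟨w, hw, hwsub, rfl⟩, hcw⟩
  refine ⟨hsub, isSupersolOn_lscEnv hbump hΩopen hFcont hs₀cont hs₁cont hs₁ h₀' h₁' hsub ?_,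
    fun x hx => ⟨le_lscEnv_of_le hs₀cont h₀' hs₁cont h₁' hx, lscEnv_le hs₀cont h₀' hx, h₁' x hx⟩⟩
  intro w hw hUw hws₁ y hy
  exact ((hu y hy).1 ⟨w, fun z hz => ⟨(h₀' z hz).trans (hUw z hz), hws₁ z hz⟩, hw, rfl⟩).trans
    (hle_env y hy)
end
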